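/- For every integer k with 0 ≤ k ≤ 4, every bipartite outer k-planar graph on n ≥ 2 vertices has at most ((k + 3.5)·n − (2k + 5)) / 2 edges. -/

import Mathlib

open scoped Classical

/-- A point in the plane. -/
abbrev Pt := EuclideanSpace ℝ (Fin 2)

/-- A finite point set is in convex position (convexly independent). -/
def ConvexPos (V : Finset Pt) : Prop :=
  ∀ p ∈ V, p ∉ convexHull ℝ ((V.erase p : Finset Pt) : Set Pt)

/-- The open straight-line segment drawn for an unordered pair of points. -/
noncomputable def edgeSeg (e : Sym2 Pt) : Set Pt :=
  Sym2.lift ⟨fun a b => openSegment ℝ a b, fun a b => openSegment_symm ℝ a b⟩ e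

/-- Two distinct edges cross if their open segments intersect. -/
def Cross (e f : Sym2 Pt) : Prop :=
  e ≠ f ∧ (edgeSeg e ∩ edgeSeg f).Nonempty

theorem Cross_comm (e f : Sym2 Pt) : Cross e f ↔ Cross f e := by
  unfold Cross
  rw [Set.inter_comm]
  exact and_congr_left' ne_comm

/-- A convex geometric graph: points in convex position, edges are unordered
pairs of distinct points of `V`. -/
structure ConvexGeomGraph where
  V : Finset Pt
  E : Finset (Sym2 Pt)
  convexPos : ConvexPos V
  not_diag : ∀ e ∈ E, ¬ e.IsDiag
  mem_V : ∀ e ∈ E, ∀ p ∈ e, p ∈ V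

/-- A convex geometric graph is outer `k`-planar if every edge crosses at
most `k` other edges. -/
noncomputable def OuterKPlanar (G : ConvexGeomGraph) (k : ℕ) : Prop :=
  ∀ e ∈ G.E, (G.E.filter (fun f => Cross e f)).card ≤ k

/-- Bipartite: vertices can be partitioned into `A` and `B` with every edge
joining a point of `A` to a point of `B`. -/
def Bipartite (G : ConvexGeomGraph) : Prop :=
  ∃ A B : Finset Pt, A ∪ B = G.V ∧ Disjoint A B ∧
    ∀ e ∈ G.E, ∃ a ∈ A, ∃ b ∈ B, e = s(a, b)

/-- The degree of a vertex: number of edges containing it. -/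
noncomputable def degree (G : ConvexGeomGraph) (v : Pt) : ℕ :=
  (G.E.filter (fun e => v ∈ e)).card

/-- The number of unordered pairs of distinct edges that cross. -/
noncomputable def crossingNumber (E : Finset (Sym2 Pt)) : ℕ :=
  (E.sym2.filter (fun pr => Sym2.lift
    ⟨fun e f => Cross e f, fun e f => propext (Cross_comm e f)⟩ pr)).card

/-- `z` lies strictly between `p` and `q`. -/
def Inside (p q z : ℕ) : Prop := (p < z ∧ z < q) ∨ (q < z ∧ z < p)

/-- `z` lies strictly outside the interval spanned by `p` and `q`. -/
def Outside (p q z : ℕ) : Prop := (z < p ∧ z < q) ∨ (p < z ∧ q < z)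

/-- The chords `x` and `y` interleave. -/
def Interleave (x y : ℕ × ℕ) : Prop :=
  (Inside x.1 x.2 y.1 ∧ Outside x.1 x.2 y.2) ∨ (Inside x.1 x.2 y.2 ∧ Outside x.1 x.2 y.1)

/-- The chords of `X` that interleave with `x`. -/
noncomputable def crossers (X : Finset (ℕ × ℕ)) (x : ℕ × ℕ) : Finset (ℕ × ℕ) :=
  X.filter (Interleave x)

/-- The chords of `X` starting at `e`. -/
noncomputable def chordsFrom (X : Finset (ℕ × ℕ)) (e : ℕ) : Finset (ℕ × ℕ) :=
  X.filter (fun y => y.1 = e)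

/-- The chords of `X` ending in the gap between `p` and `q`. -/
noncomputable def chordsInto (X : Finset (ℕ × ℕ)) (p q : ℕ) : Finset (ℕ × ℕ) :=
  X.filter (fun y => p < y.2 ∧ y.2 < q)

/-- The chords of `X` ending outside of `[a, b]`. -/
noncomputable def chordsOut (X : Finset (ℕ × ℕ)) (a b : ℕ) : Finset (ℕ × ℕ) :=
  X.filter (fun y => y.2 < a ∨ b < y.2)

/-- `p < q` are elements of `U` with no element of `U` in between. -/
def Consec (U : Finset ℕ) (p q : ℕ) : Prop :=
  p ∈ U ∧ q ∈ U ∧ p < q ∧ ∀ u ∈ U, ¬ (p < u ∧ u < q)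

/-- Of two different chords of `S` with a common start, one is crossed by at most `k - 2`
chords of `X`. -/
def Sparse (k : ℕ) (X S : Finset (ℕ × ℕ)) : Prop :=
  ∀ x ∈ S, ∀ y ∈ S, x ≠ y → x.1 = y.1 →
    (crossers X x).card + 2 ≤ k ∨ (crossers X y).card + 2 ≤ k

/-- Chords leaving the convex polygon with vertex set `U ⊆ [a, b]` through a side that is not
incident to their start. -/
structure FaceChords (k : ℕ) (U : Finset ℕ) (a b : ℕ) (X : Finset (ℕ × ℕ)) : Prop where
  ha : a ∈ U
  hb : b ∈ U
  hab : a < b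
  hU : ∀ u ∈ U, a ≤ u ∧ u ≤ b
  src : ∀ x ∈ X, x.1 ∈ U
  tgt : ∀ x ∈ X, x.2 ∉ U
  inner : ∀ x ∈ X, a < x.2 → x.2 < b → ∃ u ∈ U, Inside x.1 x.2 u
  outer : ∀ x ∈ X, (x.2 < a ∨ b < x.2) → a < x.1 ∧ x.1 < b
  cross : ∀ x ∈ X, (crossers X x).card + 1 ≤ k
  out_card : (chordsOut X a b).card ≤ k
  gap_card : ∀ p q, Consec U p q → (chordsInto X p q).card ≤ k
  gap_sparse : ∀ p q, Consec U p q →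
    (chordsInto X p q).card ≤ 2 ∨ Sparse k X (chordsInto X p q)

theorem Consec.exists_succ {U : Finset ℕ} {p b : ℕ} (hp : p ∈ U) (hb : b ∈ U) (h : p < b) :
    ∃ q, Consec U p q := by
  have hne : (U.filter (fun u => p < u)).Nonempty := ⟨b, by simp [hb, h]⟩
  obtain ⟨q, hq, hmin⟩ := Finset.exists_min_image _ id hne
  simp only [Finset.mem_filter, id] at hq hmin
  exact ⟨q, hp, hq.1, hq.2, fun u hu hpu => by
    have := hmin u ⟨hu, hpu.1⟩
    omega⟩

theorem Consec.exists_pred {U : Finset ℕ} {q a : ℕ} (hq : q ∈ U) (ha : a ∈ U) (h : a < q) :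
    ∃ p, Consec U p q := by
  have hne : (U.filter (fun u => u < q)).Nonempty := ⟨a, by simp [ha, h]⟩
  obtain ⟨p, hp, hmax⟩ := Finset.exists_max_image _ id hne
  simp only [Finset.mem_filter, id] at hp hmax
  exact ⟨p, hp.1, hq, hp.2, fun u hu hpu => by
    have := hmax u ⟨hu, hpu.2⟩
    omega⟩

namespace FaceChords

variable {k : ℕ} {U : Finset ℕ} {a b : ℕ} {X : Finset (ℕ × ℕ)}

theorem card_inside_lt {x y : ℕ × ℕ} (hsub : ∀ u ∈ U, Inside y.1 y.2 u → Inside x.1 x.2 u)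
    {v : ℕ} (hv : v ∈ U) (hvx : Inside x.1 x.2 v) (hvy : ¬ Inside y.1 y.2 v) :
    (U.filter (Inside y.1 y.2)).card < (U.filter (Inside x.1 x.2)).card := by
  apply Finset.card_lt_card
  rw [Finset.ssubset_iff_of_subset]
  · exact ⟨v, by simp [hv, hvx], by simp [hvy]⟩
  · intro u hu
    simp only [Finset.mem_filter] at hu ⊢
    exact ⟨hu.1, hsub u hu.1 hu.2⟩

theorem card_add_card_le_crossers {x : ℕ × ℕ}
    {A B : Finset (ℕ × ℕ)} (hA : ∀ y ∈ A, y ∈ X ∧ Interleave x y)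
    (hB : ∀ y ∈ B, y ∈ X ∧ Interleave x y) (hAB : ∀ y ∈ A, y ∉ B) :
    A.card + B.card ≤ (crossers X x).card := by
  rw [← Finset.card_union_of_disjoint (Finset.disjoint_left.2 hAB)]
  apply Finset.card_le_card
  intro y hy
  simp only [crossers, Finset.mem_filter, Finset.mem_union] at hy ⊢
  exact hy.elim (hA y) (hB y)

theorem not_chordsInto_of_consec (h : FaceChords k U a b X) {p q : ℕ} (hpq : Consec U p q)
    {y : ℕ × ℕ} (hy : y ∈ X) (hp : p < y.2) (hq : y.2 < q) : y.1 < p ∨ q < y.1 := by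
  obtain ⟨u, hu, hub⟩ := h.inner y hy (by have := h.hU p hpq.1; omega)
    (by have := h.hU q hpq.2.1; omega)
  have h1 := hpq.2.2.2 u hu
  have h2 := hpq.2.2.2 _ (h.src y hy)
  unfold Inside at hub
  omega

theorem ear_of_lt (h : FaceChords k U a b X) {x : ℕ × ℕ} (hx : x ∈ X)
    (hxa : a < x.2) (hxb : x.2 < b) (hlt : x.1 < x.2)
    (hmin : ∀ y ∈ X, a < y.2 → y.2 < b →
      (U.filter (Inside x.1 x.2)).card ≤ (U.filter (Inside y.1 y.2)).card) :
    ∃ p e q, Consec U p e ∧ Consec U e q ∧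
      (chordsFrom X e).card + (chordsInto X p e).card + 1 ≤ k := by
  obtain ⟨v, hv, hvx⟩ := h.inner x hx hxa hxb
  obtain ⟨e, he⟩ := Consec.exists_succ (h.src x hx) h.hb (hlt.trans hxb)
  have hev : e ≤ v := by
    have := he.2.2.2 v hv
    unfold Inside at hvx
    omega
  have hex : e < x.2 := by unfold Inside at hvx; omega
  obtain ⟨q, hq⟩ := Consec.exists_succ he.2.1 h.hb (hex.trans hxb)
  have hpe := he.2.2.1
  have hxe : Inside x.1 x.2 e := by unfold Inside; omega
  have hax := h.hU _ (h.src x hx)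
  refine ⟨x.1, e, q, he, hq, (Nat.add_le_add_right
    (card_add_card_le_crossers ?_ ?_ ?_) 1).trans (h.cross x hx)⟩
  · intro y hy
    simp only [chordsFrom, Finset.mem_filter] at hy
    obtain ⟨hy, rfl⟩ := hy
    refine ⟨hy, Or.inl ⟨hxe, ?_⟩⟩
    by_contra hout
    have hy2 : y.2 ≠ x.1 := fun hh => h.tgt y hy (hh ▸ h.src x hx)
    unfold Outside at hout
    refine absurd (hmin y hy (by omega) (by omega)) (not_le.2 (card_inside_lt ?_ he.2.1 hxe ?_))
    · intro u _ hu
      unfold Inside at *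
      omega
    · unfold Inside
      omega
  · intro y hy
    simp only [chordsInto, Finset.mem_filter] at hy
    obtain ⟨hy, hy1, hy2⟩ := hy
    have hnc := h.not_chordsInto_of_consec he hy hy1 hy2
    have hyx : y.1 ≠ x.2 := fun hh => h.tgt x hx (hh ▸ h.src y hy)
    refine ⟨hy, Or.inr ⟨by unfold Inside; omega, ?_⟩⟩
    by_contra hout
    unfold Outside at hout
    have hyx' : Inside x.1 x.2 y.1 := by unfold Inside; omega
    refine absurd (hmin y hy (by omega) (by omega))
      (not_le.2 (card_inside_lt ?_ (h.src y hy) hyx' ?_))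
    · intro u _ hu
      unfold Inside at *
      omega
    · unfold Inside
      omega
  · intro y hy hy'
    simp only [chordsFrom, chordsInto, Finset.mem_filter] at hy hy'
    have := h.not_chordsInto_of_consec he hy.1 hy'.2.1 hy'.2.2
    omega

theorem ear_of_gt (h : FaceChords k U a b X) {x : ℕ × ℕ} (hx : x ∈ X)
    (hxa : a < x.2) (hxb : x.2 < b) (hlt : x.2 < x.1)
    (hmin : ∀ y ∈ X, a < y.2 → y.2 < b →
      (U.filter (Inside x.1 x.2)).card ≤ (U.filter (Inside y.1 y.2)).card) :
    ∃ p e q, Consec U p e ∧ Consec U e q ∧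
      (chordsFrom X e).card + (chordsInto X e q).card + 1 ≤ k := by
  obtain ⟨v, hv, hvx⟩ := h.inner x hx hxa hxb
  obtain ⟨e, he⟩ := Consec.exists_pred (h.src x hx) h.ha (hxa.trans hlt)
  have hev : v ≤ e := by
    have := he.2.2.2 v hv
    unfold Inside at hvx
    omega
  have hex : x.2 < e := by unfold Inside at hvx; omega
  obtain ⟨p, hp⟩ := Consec.exists_pred he.1 h.ha (hxa.trans hex)
  have hpe := he.2.2.1
  have hxe : Inside x.1 x.2 e := by unfold Inside; omega
  have hax := h.hU _ (h.src x hx)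
  refine ⟨p, e, x.1, hp, he, (Nat.add_le_add_right
    (card_add_card_le_crossers ?_ ?_ ?_) 1).trans (h.cross x hx)⟩
  · intro y hy
    simp only [chordsFrom, Finset.mem_filter] at hy
    obtain ⟨hy, rfl⟩ := hy
    refine ⟨hy, Or.inl ⟨hxe, ?_⟩⟩
    by_contra hout
    have hy2 : y.2 ≠ x.1 := fun hh => h.tgt y hy (hh ▸ h.src x hx)
    unfold Outside at hout
    refine absurd (hmin y hy (by omega) (by omega)) (not_le.2 (card_inside_lt ?_ he.1 hxe ?_))
    · intro u _ hu
      unfold Inside at *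
      omega
    · unfold Inside
      omega
  · intro y hy
    simp only [chordsInto, Finset.mem_filter] at hy
    obtain ⟨hy, hy1, hy2⟩ := hy
    have hnc := h.not_chordsInto_of_consec he hy hy1 hy2
    have hyx : y.1 ≠ x.2 := fun hh => h.tgt x hx (hh ▸ h.src y hy)
    refine ⟨hy, Or.inr ⟨by unfold Inside; omega, ?_⟩⟩
    by_contra hout
    unfold Outside at hout
    have hyx' : Inside x.1 x.2 y.1 := by unfold Inside; omega
    refine absurd (hmin y hy (by omega) (by omega))
      (not_le.2 (card_inside_lt ?_ (h.src y hy) hyx' ?_))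
    · intro u _ hu
      unfold Inside at *
      omega
    · unfold Inside
      omega
  · intro y hy hy'
    simp only [chordsFrom, chordsInto, Finset.mem_filter] at hy hy'
    have := h.not_chordsInto_of_consec he hy.1 hy'.2.1 hy'.2.2
    omega

theorem exists_ear (h : FaceChords k U a b X) (hX : ∃ x ∈ X, a < x.2 ∧ x.2 < b) :
    ∃ p e q, Consec U p e ∧ Consec U e q ∧
      ((chordsFrom X e).card + (chordsInto X p e).card + 1 ≤ k ∨
        (chordsFrom X e).card + (chordsInto X e q).card + 1 ≤ k) := by
  have hne : (X.filter (fun x => a < x.2 ∧ x.2 < b)).Nonempty := by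
    obtain ⟨x, hx, hx'⟩ := hX
    exact ⟨x, by simp [hx, hx']⟩
  obtain ⟨x, hx, hmin⟩ :=
    Finset.exists_min_image _ (fun x => (U.filter (Inside x.1 x.2)).card) hne
  simp only [Finset.mem_filter] at hx hmin
  have hmin' : ∀ y ∈ X, a < y.2 → y.2 < b →
      (U.filter (Inside x.1 x.2)).card ≤ (U.filter (Inside y.1 y.2)).card :=
    fun y hy h1 h2 => hmin y ⟨hy, h1, h2⟩
  rcases lt_trichotomy x.1 x.2 with hlt | heq | hgt
  · obtain ⟨p, e, q, h1, h2, h3⟩ := h.ear_of_lt hx.1 hx.2.1 hx.2.2 hlt hmin'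
    exact ⟨p, e, q, h1, h2, Or.inl h3⟩
  · exact absurd (heq ▸ h.src x hx.1) (h.tgt x hx.1)
  · obtain ⟨p, e, q, h1, h2, h3⟩ := h.ear_of_gt hx.1 hx.2.1 hx.2.2 hgt hmin'
    exact ⟨p, e, q, h1, h2, Or.inr h3⟩

/-- A class of chords with a common start and a common sparse gap, each of which is crossed by
at least `σ` others. -/
theorem card_class (h : FaceChords k U a b X) {S G : Finset (ℕ × ℕ)} (hSX : S ⊆ X)
    (hSG : S ⊆ G) (hG : Sparse k X G) {u σ : ℕ} (hu : ∀ x ∈ S, x.1 = u)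
    (hσ : ∀ x ∈ S, σ ≤ (crossers X x).card) :
    S.card = 0 ∨ (σ + 1 ≤ k ∧ (S.card = 1 ∨ σ + 2 ≤ k)) := by
  rcases S.eq_empty_or_nonempty with rfl | ⟨x, hx⟩
  · simp
  · refine Or.inr ⟨(Nat.add_le_add_right (hσ x hx) 1).trans (h.cross x (hSX hx)), ?_⟩
    by_cases h1 : S.card = 1
    · exact Or.inl h1
    · have hpos : 0 < S.card := Finset.card_pos.2 ⟨x, hx⟩
      obtain ⟨y, hy, z, hz, hyz⟩ := Finset.one_lt_card.1 (show 1 < S.card by omega)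
      have := hσ y hy
      have := hσ z hz
      have := hG y (hSG hy) z (hSG hz) hyz ((hu y hy).trans (hu z hz).symm)
      omega

/-- The chords meeting the triangle cut off by the diagonal from `p` to `q`. -/
theorem ear_card_le (h : FaceChords k U a b X) (hk : k ≤ 4) {p e q : ℕ} (hpe : Consec U p e)
    (heq : Consec U e q) (hA : (chordsFrom X e).card + 1 ≤ k) :
    (chordsFrom X e).card + (chordsFrom (chordsInto X p e) q).card +
      (chordsFrom (chordsInto X e q) p).card ≤ k + 1 := by
  have hBk : (chordsFrom (chordsInto X p e) q).card ≤ (chordsInto X p e).card :=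
    Finset.card_le_card (Finset.filter_subset _ _)
  have hCk : (chordsFrom (chordsInto X e q) p).card ≤ (chordsInto X e q).card :=
    Finset.card_le_card (Finset.filter_subset _ _)
  have hBg := h.gap_card p e hpe
  have hCg := h.gap_card e q heq
  have mA : ∀ y, y ∈ chordsFrom X e ↔ y ∈ X ∧ y.1 = e := by simp [chordsFrom]
  have mB : ∀ y, y ∈ chordsFrom (chordsInto X p e) q ↔
      (y ∈ X ∧ p < y.2 ∧ y.2 < e) ∧ y.1 = q := by simp [chordsFrom, chordsInto]
  have mC : ∀ y, y ∈ chordsFrom (chordsInto X e q) p ↔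
      (y ∈ X ∧ e < y.2 ∧ y.2 < q) ∧ y.1 = p := by simp [chordsFrom, chordsInto]
  have hpe' := hpe.2.2.1
  have heq' := heq.2.2.1
  have hAout : ∀ y ∈ X, y.1 = e → y.2 < p ∨ q < y.2 := by
    intro y hy hye
    have h1 := h.not_chordsInto_of_consec hpe hy
    have h2 := h.not_chordsInto_of_consec heq hy
    have h3 : y.2 ≠ p := fun hh => h.tgt y hy (hh ▸ hpe.1)
    have h4 : y.2 ≠ q := fun hh => h.tgt y hy (hh ▸ heq.2.1)
    have h5 : y.2 ≠ e := fun hh => h.tgt y hy (hh ▸ heq.1)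
    omega
  have cA : ∀ x ∈ chordsFrom X e, (chordsFrom (chordsInto X p e) q).card +
      (chordsFrom (chordsInto X e q) p).card ≤ (crossers X x).card := by
    intro x hx
    rw [mA] at hx
    have := hAout x hx.1 hx.2
    refine card_add_card_le_crossers ?_ ?_ ?_
    · intro y hy
      rw [mB] at hy
      exact ⟨hy.1.1, by unfold Interleave Inside Outside; omega⟩
    · intro y hy
      rw [mC] at hy
      exact ⟨hy.1.1, by unfold Interleave Inside Outside; omega⟩
    · intro y hy
      rw [mB] at hy
      rw [mC]
      omega
  have cB : ∀ x ∈ chordsFrom (chordsInto X p e) q, (chordsFrom X e).card +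
      (chordsFrom (chordsInto X e q) p).card ≤ (crossers X x).card := by
    intro x hx
    rw [mB] at hx
    refine card_add_card_le_crossers ?_ ?_ ?_
    · intro y hy
      rw [mA] at hy
      have := hAout y hy.1 hy.2
      exact ⟨hy.1, by unfold Interleave Inside Outside; omega⟩
    · intro y hy
      rw [mC] at hy
      exact ⟨hy.1.1, by unfold Interleave Inside Outside; omega⟩
    · intro y hy
      rw [mA] at hy
      rw [mC]
      omega
  have cC : ∀ x ∈ chordsFrom (chordsInto X e q) p, (chordsFrom X e).card +
      (chordsFrom (chordsInto X p e) q).card ≤ (crossers X x).card := by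
    intro x hx
    rw [mC] at hx
    refine card_add_card_le_crossers ?_ ?_ ?_
    · intro y hy
      rw [mA] at hy
      have := hAout y hy.1 hy.2
      exact ⟨hy.1, by unfold Interleave Inside Outside; omega⟩
    · intro y hy
      rw [mB] at hy
      exact ⟨hy.1.1, by unfold Interleave Inside Outside; omega⟩
    · intro y hy
      rw [mA] at hy
      rw [mB]
      omega
  have kA : (chordsFrom X e).card = 0 ∨ (chordsFrom (chordsInto X p e) q).card +
      (chordsFrom (chordsInto X e q) p).card + 1 ≤ k := by
    rcases (chordsFrom X e).eq_empty_or_nonempty with h0 | ⟨x, hx⟩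
    · exact Or.inl (by rw [h0, Finset.card_empty])
    · have := cA x hx
      have := h.cross x ((mA x).1 hx).1
      omega
  have kB := h.gap_sparse p e hpe
  have kC := h.gap_sparse e q heq
  have kB' : (chordsFrom (chordsInto X p e) q).card ≤ 2 →
      (chordsFrom (chordsInto X p e) q).card = 0 ∨ (chordsFrom X e).card +
      (chordsFrom (chordsInto X e q) p).card + 1 ≤ k := by
    intro _
    rcases (chordsFrom (chordsInto X p e) q).eq_empty_or_nonempty with h0 | ⟨x, hx⟩
    · exact Or.inl (by rw [h0, Finset.card_empty])
    · have := cB x hx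
      have := h.cross x ((mB x).1 hx).1.1
      omega
  have kC' : (chordsFrom (chordsInto X e q) p).card ≤ 2 →
      (chordsFrom (chordsInto X e q) p).card = 0 ∨ (chordsFrom X e).card +
      (chordsFrom (chordsInto X p e) q).card + 1 ≤ k := by
    intro _
    rcases (chordsFrom (chordsInto X e q) p).eq_empty_or_nonempty with h0 | ⟨x, hx⟩
    · exact Or.inl (by rw [h0, Finset.card_empty])
    · have := cC x hx
      have := h.cross x ((mC x).1 hx).1.1
      omega
  have sB : (chordsInto X p e).card ≤ 2 ∨ _ := kB.imp_right fun hs =>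
    h.card_class (S := chordsFrom (chordsInto X p e) q)
      (fun x hx => ((mB x).1 hx).1.1) (Finset.filter_subset _ _) hs
      (fun x hx => ((mB x).1 hx).2) cB
  have sC : (chordsInto X e q).card ≤ 2 ∨ _ := kC.imp_right fun hs =>
    h.card_class (S := chordsFrom (chordsInto X e q) p)
      (fun x hx => ((mC x).1 hx).1.1) (Finset.filter_subset _ _) hs
      (fun x hx => ((mC x).1 hx).2) cC
  omega

theorem crossers_mono {X' : Finset (ℕ × ℕ)} (hX : X' ⊆ X) (x : ℕ × ℕ) :
    (crossers X' x).card ≤ (crossers X x).card :=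
  Finset.card_le_card (Finset.filter_subset_filter _ hX)

theorem card_le (hk : k ≤ 4) (h : FaceChords k U a b X) :
    X.card ≤ (U.card - 2) * (k + 1) := by
  induction hs : U.card generalizing U X with
  | zero =>
    have := Finset.card_pos.2 ⟨a, h.ha⟩
    omega
  | succ s ih =>
    by_cases hX : ∃ x ∈ X, a < x.2 ∧ x.2 < b
    · obtain ⟨p, e, q, hpe, heq, hear⟩ := h.exists_ear hX
      have hA : (chordsFrom X e).card + 1 ≤ k := by omega
      have hT := h.ear_card_le hk hpe heq hA
      have hpe' := hpe.2.2.1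
      have heq' := heq.2.2.1
      have hpa := h.hU p hpe.1
      have hqb := h.hU q heq.2.1
      have hgL := h.gap_card p e hpe
      have hgR := h.gap_card e q heq
      set A := chordsFrom X e with hAdef
      set B := chordsFrom (chordsInto X p e) q with hBdef
      set C := chordsFrom (chordsInto X e q) p with hCdef
      set S := (chordsInto X p q) \ (A ∪ B ∪ C) with hSdef
      obtain ⟨S', hS', hS'card⟩ := Finset.exists_subset_card_eq (min_le_right 2 S.card)
      set R := A ∪ B ∪ C ∪ S with hRdef
      have hABC : (A ∪ B ∪ C).card ≤ A.card + B.card + C.card :=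
        (Finset.card_union_le _ _).trans (Nat.add_le_add_right (Finset.card_union_le _ _) _)
      have hR1 : R.card ≤ A.card + B.card + C.card + S.card :=
        (Finset.card_union_le _ _).trans (Nat.add_le_add_right hABC _)
      have hR2 : R.card ≤ A.card + (chordsInto X p e).card + (chordsInto X e q).card := by
        have hsub : R ⊆ A ∪ chordsInto X p e ∪ chordsInto X e q := by
          intro y hy
          have hye : y ∈ X → y.2 ≠ e := fun hyX hh => h.tgt y hyX (hh ▸ heq.1)
          simp only [hRdef, hSdef, hBdef, hCdef, chordsFrom, chordsInto, Finset.mem_union,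
            Finset.mem_sdiff, Finset.mem_filter] at hy ⊢
          rcases hy with ((hy | hy) | hy) | hy
          · exact Or.inl (Or.inl hy)
          · exact Or.inl (Or.inr hy.1)
          · exact Or.inr hy.1
          · have := hye hy.1.1
            by_cases hlt : y.2 < e
            · exact Or.inl (Or.inr ⟨hy.1.1, hy.1.2.1, hlt⟩)
            · exact Or.inr ⟨hy.1.1, by omega, hy.1.2.2⟩
        exact (Finset.card_le_card hsub).trans ((Finset.card_union_le _ _).trans
          (Nat.add_le_add_right (Finset.card_union_le _ _) _))
      have hRX : R ⊆ X := by
        intro y hy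
        simp only [hRdef, hSdef, hAdef, hBdef, hCdef, chordsFrom, chordsInto, Finset.mem_union,
          Finset.mem_sdiff, Finset.mem_filter] at hy
        tauto
      have hSR : S ⊆ R := Finset.subset_union_right
      have hX'X : (X \ R) ∪ S' ⊆ X :=
        Finset.union_subset Finset.sdiff_subset (hS'.trans (hSR.trans hRX))
      have hX'card : ((X \ R) ∪ S').card = X.card - R.card + S'.card := by
        rw [Finset.card_union_of_disjoint, Finset.card_sdiff_of_subset hRX]
        exact Finset.disjoint_left.2 fun y hy hyS =>
          (Finset.mem_sdiff.1 hy).2 (hSR (hS' hyS))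
      have hRcard := Finset.card_le_card hRX
      have hSn : ∀ y ∈ S', y ∉ A ∪ B ∪ C := fun y hy => (Finset.mem_sdiff.1 (hS' hy)).2
      have hX'n : ∀ y ∈ (X \ R) ∪ S', y ∉ A ∪ B ∪ C := by
        intro y hy
        rcases Finset.mem_union.1 hy with hy | hy
        · exact fun hn => (Finset.mem_sdiff.1 hy).2 (Finset.mem_union_left _ hn)
        · exact hSn y hy
      have hUe : (U.erase e).card = s := by
        rw [Finset.card_erase_of_mem heq.1, hs]
        omega
      have hnew : FaceChords k (U.erase e) a b ((X \ R) ∪ S') := by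
        have hgapU : ∀ p' q', Consec (U.erase e) p' q' → ¬ Consec U p' q' →
            p' = p ∧ q' = q := by
          intro p' q' hc hn
          obtain ⟨h1, h2, h3, h4⟩ := hc
          rw [Finset.mem_erase] at h1 h2
          have he : p' < e ∧ e < q' := by
            by_contra hcon
            refine hn ⟨h1.2, h2.2, h3, fun u hu hpu => ?_⟩
            exact h4 u (Finset.mem_erase.2 ⟨by rintro rfl; exact hcon hpu, hu⟩) hpu
          have h5 := h4 p (Finset.mem_erase.2 ⟨by omega, hpe.1⟩)
          have h6 := h4 q (Finset.mem_erase.2 ⟨by omega, heq.2.1⟩)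
          have h7 := hpe.2.2.2 p' h1.2
          have h8 := heq.2.2.2 q' h2.2
          omega
        have hgapS : (chordsInto ((X \ R) ∪ S') p q).card ≤ 2 := by
          have : chordsInto ((X \ R) ∪ S') p q ⊆ S' := by
            intro y hy
            simp only [chordsInto, Finset.mem_filter] at hy
            rcases Finset.mem_union.1 hy.1 with hyX | hyS
            · refine absurd (hSR ?_) (Finset.mem_sdiff.1 hyX).2
              refine Finset.mem_sdiff.2 ⟨?_, hX'n y hy.1⟩
              exact Finset.mem_filter.2 ⟨hX'X hy.1, hy.2⟩
            · exact hyS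
          have := Finset.card_le_card this
          omega
        have hsparse : ∀ p' q', Sparse k X (chordsInto X p' q') →
            Sparse k ((X \ R) ∪ S') (chordsInto ((X \ R) ∪ S') p' q') := by
          intro p' q' hsp x hx y hy hxy h1
          have hsub : chordsInto ((X \ R) ∪ S') p' q' ⊆ chordsInto X p' q' :=
            Finset.filter_subset_filter _ hX'X
          have := hsp x (hsub hx) y (hsub hy) hxy h1
          have := crossers_mono hX'X x
          have := crossers_mono hX'X y
          omega
        have hsubInto : ∀ p' q', (chordsInto ((X \ R) ∪ S') p' q').card ≤
            (chordsInto X p' q').card := fun p' q' =>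
          Finset.card_le_card (Finset.filter_subset_filter _ hX'X)
        have hk2 : 2 ≤ k ∨ (chordsInto ((X \ R) ∪ S') p q).card ≤ k := by
          by_contra hcon
          have : (chordsInto ((X \ R) ∪ S') p q) ⊆ chordsInto X p e ∪ chordsInto X e q := by
            intro y hy
            rw [chordsInto, Finset.mem_filter] at hy
            simp only [chordsInto, Finset.mem_filter, Finset.mem_union]
            have hyX := hX'X hy.1
            have : y.2 ≠ e := fun hh => h.tgt y hyX (hh ▸ heq.1)
            by_cases hlt : y.2 < e
            · exact Or.inl ⟨hyX, hy.2.1, hlt⟩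
            · exact Or.inr ⟨hyX, by omega, hy.2.2⟩
          have := (Finset.card_le_card this).trans (Finset.card_union_le _ _)
          omega
        refine
          { ha := Finset.mem_erase.2 ⟨by omega, h.ha⟩
            hb := Finset.mem_erase.2 ⟨by omega, h.hb⟩
            hab := h.hab
            hU := fun u hu => h.hU u (Finset.mem_of_mem_erase hu)
            src := fun x hx => Finset.mem_erase.2 ⟨fun hh => hX'n x hx ?_, h.src x (hX'X hx)⟩
            tgt := fun x hx hh => h.tgt x (hX'X hx) (Finset.mem_of_mem_erase hh)
            inner := ?_
            outer := fun x hx => h.outer x (hX'X hx)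
            cross := fun x hx =>
              (Nat.add_le_add_right (crossers_mono hX'X x) 1).trans (h.cross x (hX'X hx))
            out_card :=
              (Finset.card_le_card (Finset.filter_subset_filter _ hX'X)).trans h.out_card
            gap_card := ?_
            gap_sparse := ?_ }
        · exact Finset.mem_union_left _ (Finset.mem_union_left _
            (Finset.mem_filter.2 ⟨hX'X hx, hh⟩))
        · intro x hx hxa hxb
          have hxX := hX'X hx
          obtain ⟨u, hu, hxu⟩ := h.inner x hxX hxa hxb
          by_cases hue : u = e
          · subst hue
            have h1 := hX'n x hx
            simp only [hBdef, hCdef, chordsFrom, chordsInto, Finset.mem_union,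
              Finset.mem_filter, not_or, not_and, and_imp] at h1
            have h2 : x.2 ≠ p := fun hh => h.tgt x hxX (hh ▸ hpe.1)
            have h3 : x.2 ≠ q := fun hh => h.tgt x hxX (hh ▸ heq.2.1)
            have h4 := h1.1.2 hxX
            have h5 := h1.2 hxX
            have h6 := hpe.2.2.2 _ (h.src x hxX)
            have h7 := heq.2.2.2 _ (h.src x hxX)
            by_cases hp : Inside x.1 x.2 p
            · exact ⟨p, Finset.mem_erase.2 ⟨by omega, hpe.1⟩, hp⟩
            · refine ⟨q, Finset.mem_erase.2 ⟨by omega, heq.2.1⟩, ?_⟩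
              unfold Inside at *
              omega
          · exact ⟨u, Finset.mem_erase.2 ⟨hue, hu⟩, hxu⟩
        · intro p' q' hc
          by_cases hcU : Consec U p' q'
          · exact (hsubInto p' q').trans (h.gap_card p' q' hcU)
          · obtain ⟨rfl, rfl⟩ := hgapU p' q' hc hcU
            omega
        · intro p' q' hc
          by_cases hcU : Consec U p' q'
          · rcases h.gap_sparse p' q' hcU with h2 | h2
            · exact Or.inl ((hsubInto p' q').trans h2)
            · exact Or.inr (hsparse p' q' h2)
          · obtain ⟨rfl, rfl⟩ := hgapU p' q' hc hcU
            exact Or.inl hgapS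
      have hih := ih hnew hUe
      have hs2 : 2 ≤ s := by
        rw [← hUe]
        exact Finset.one_lt_card.2 ⟨a, hnew.ha, b, hnew.hb, h.hab.ne⟩
      obtain ⟨t, rfl⟩ := Nat.exists_eq_add_of_le hs2
      have e1 : 2 + t + 1 - 2 = t + 1 := by omega
      have e2 : 2 + t - 2 = t := by omega
      rw [e2] at hih
      rw [e1, add_mul, one_mul]
      omega
    · rcases X.eq_empty_or_nonempty with rfl | ⟨x, hx⟩
      · simp
      · have hout : ∀ y ∈ X, y.2 < a ∨ b < y.2 := by
          intro y hy
          have h1 : y.2 ≠ a := fun hh => h.tgt y hy (hh ▸ h.ha)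
          have h2 : y.2 ≠ b := fun hh => h.tgt y hy (hh ▸ h.hb)
          have h3 : ¬ (a < y.2 ∧ y.2 < b) := fun hh => hX ⟨y, hy, hh⟩
          omega
        have hXk : X.card ≤ k := by
          have : chordsOut X a b = X := Finset.filter_true_of_mem hout
          rw [← this]
          exact h.out_card
        have hab := h.hab
        have hx1 := h.outer x hx (hout x hx)
        have h3 : 3 ≤ U.card := by
          have : ({a, x.1, b} : Finset ℕ) ⊆ U := by
            intro u hu
            simp only [Finset.mem_insert, Finset.mem_singleton] at hu
            rcases hu with rfl | rfl | rfl
            exacts [h.ha, h.src x hx, h.hb]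
          have hc := Finset.card_le_card this
          rw [Finset.card_eq_three.2 ⟨a, x.1, b, by omega, by omega, by omega, rfl⟩] at hc
          exact hc
        have : 1 * (k + 1) ≤ (s + 1 - 2) * (k + 1) := Nat.mul_le_mul_right _ (by omega)
        omega

end FaceChords

theorem quad_arith (k p1 p2 p3 p4 q1 q2 q3 q4 : ℕ) (hk : k ≤ 4)
    (g1 : p4 + q3 ≤ k) (g2 : p1 + q4 ≤ k) (g3 : p2 + q1 ≤ k) (g4 : p3 + q2 ≤ k)
    (a1 : p1 = 0 ∨ (p2+q2+q3+p4+1 ≤ k ∧ (p1 = 1 ∨ p2+q2+q3+p4+2 ≤ k)))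
    (a2 : p2 = 0 ∨ (p3+q3+q4+p1+1 ≤ k ∧ (p2 = 1 ∨ p3+q3+q4+p1+2 ≤ k)))
    (a3 : p3 = 0 ∨ (p4+q4+q1+p2+1 ≤ k ∧ (p3 = 1 ∨ p4+q4+q1+p2+2 ≤ k)))
    (a4 : p4 = 0 ∨ (p1+q1+q2+p3+1 ≤ k ∧ (p4 = 1 ∨ p1+q1+q2+p3+2 ≤ k)))
    (b1 : q1 = 0 ∨ (p3+p4+q4+q2+1 ≤ k ∧ (q1 = 1 ∨ p3+p4+q4+q2+2 ≤ k)))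
    (b2 : q2 = 0 ∨ (p4+p1+q1+q3+1 ≤ k ∧ (q2 = 1 ∨ p4+p1+q1+q3+2 ≤ k)))
    (b3 : q3 = 0 ∨ (p1+p2+q2+q4+1 ≤ k ∧ (q3 = 1 ∨ p1+p2+q2+q4+2 ≤ k)))
    (b4 : q4 = 0 ∨ (p2+p3+q3+q1+1 ≤ k ∧ (q4 = 1 ∨ p2+p3+q3+q1+2 ≤ k))) :
    p1 + p2 + p3 + p4 + q1 + q2 + q3 + q4 ≤ 2 * k + 1 := by
  omega

/-- The type of a chord of a quadrilateral with vertices `a < e < f < b`: types `0, 1, 2, 3`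
leave `a, e, f, b` through the second side counterclockwise, types `4, 5, 6, 7` through the
third one. -/
def quadType (a e f b : ℕ) (y : ℕ × ℕ) : ℕ :=
  if y.1 = a then (if y.2 < f then 0 else 4)
  else if y.1 = e then (if f < y.2 ∧ y.2 < b then 1 else 5)
  else if y.1 = f then (if y.2 < a ∨ b < y.2 then 2 else 6)
  else (if y.2 < e then 3 else 7)

namespace FaceChords

variable {k a e f b : ℕ} {X : Finset (ℕ × ℕ)}

theorem sum_card_type_le_crossers {x : ℕ × ℕ} (τ : ℕ × ℕ → ℕ) (S : Finset ℕ)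
    (hS : ∀ y ∈ X, τ y ∈ S → Interleave x y) :
    ∑ i ∈ S, (X.filter (fun y => τ y = i)).card ≤ (crossers X x).card := by
  rw [← Finset.card_biUnion]
  · apply Finset.card_le_card
    intro y hy
    simp only [Finset.mem_biUnion, Finset.mem_filter] at hy
    obtain ⟨i, hi, hy, rfl⟩ := hy
    exact Finset.mem_filter.2 ⟨hy, hS y hy hi⟩
  · intro i _ j _ hij
    exact Finset.disjoint_left.2 fun y hy hy' =>
      hij ((Finset.mem_filter.1 hy).2.symm.trans (Finset.mem_filter.1 hy').2)

theorem quadType_spec (h : FaceChords k {a, e, f, b} a b X) (hae : a < e) (hef : e < f)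
    (hfb : f < b) {y : ℕ × ℕ} (hy : y ∈ X) :
    (quadType a e f b y = 0 ∧ y.1 = a ∧ e < y.2 ∧ y.2 < f) ∨
    (quadType a e f b y = 1 ∧ y.1 = e ∧ f < y.2 ∧ y.2 < b) ∨
    (quadType a e f b y = 2 ∧ y.1 = f ∧ (y.2 < a ∨ b < y.2)) ∨
    (quadType a e f b y = 3 ∧ y.1 = b ∧ a < y.2 ∧ y.2 < e) ∨
    (quadType a e f b y = 4 ∧ y.1 = a ∧ f < y.2 ∧ y.2 < b) ∨
    (quadType a e f b y = 5 ∧ y.1 = e ∧ (y.2 < a ∨ b < y.2)) ∨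
    (quadType a e f b y = 6 ∧ y.1 = f ∧ a < y.2 ∧ y.2 < e) ∨
    (quadType a e f b y = 7 ∧ y.1 = b ∧ e < y.2 ∧ y.2 < f) := by
  have h1 := h.src y hy
  have h2 := h.tgt y hy
  have h3 := h.inner y hy
  have h4 := h.outer y hy
  simp only [Finset.mem_insert, Finset.mem_singleton, not_or, exists_eq_or_imp,
    exists_eq_left] at h1 h2 h3
  unfold Inside at h3
  unfold quadType
  rcases h1 with h1 | h1 | h1 | h1 <;> rw [h1] at h3 h4 ⊢
  · rw [if_pos rfl]
    by_cases hc : y.2 < f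
    · rw [if_pos hc]
      exact Or.inl ⟨rfl, rfl, by omega, hc⟩
    · rw [if_neg hc]
      exact Or.inr <| Or.inr <| Or.inr <| Or.inr <| Or.inl ⟨rfl, rfl, by omega, by omega⟩
  · rw [if_neg hae.ne', if_pos rfl]
    by_cases hc : f < y.2 ∧ y.2 < b
    · rw [if_pos hc]
      exact Or.inr <| Or.inl ⟨rfl, rfl, hc⟩
    · rw [if_neg hc]
      exact Or.inr <| Or.inr <| Or.inr <| Or.inr <| Or.inr <| Or.inl ⟨rfl, rfl, by omega⟩
  · rw [if_neg (hae.trans hef).ne', if_neg hef.ne', if_pos rfl]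
    by_cases hc : y.2 < a ∨ b < y.2
    · rw [if_pos hc]
      exact Or.inr <| Or.inr <| Or.inl ⟨rfl, rfl, hc⟩
    · rw [if_neg hc]
      exact Or.inr <| Or.inr <| Or.inr <| Or.inr <| Or.inr <| Or.inr <| Or.inl
        ⟨rfl, rfl, by omega, by omega⟩
  · rw [if_neg h.hab.ne', if_neg (hef.trans hfb).ne', if_neg hfb.ne']
    by_cases hc : y.2 < e
    · rw [if_pos hc]
      exact Or.inr <| Or.inr <| Or.inr <| Or.inl ⟨rfl, rfl, by omega, hc⟩
    · rw [if_neg hc]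
      exact Or.inr <| Or.inr <| Or.inr <| Or.inr <| Or.inr <| Or.inr <| Or.inr
        ⟨rfl, rfl, by omega, by omega⟩

theorem card_quad_le (hk : k ≤ 4) (h : FaceChords k {a, e, f, b} a b X) (hae : a < e)
    (hef : e < f) (hfb : f < b)
    (hin : ∀ p q, Consec {a, e, f, b} p q → Sparse k X (chordsInto X p q))
    (hout : Sparse k X (chordsOut X a b)) : X.card ≤ 2 * k + 1 := by
  have c1 : Consec {a, e, f, b} a e := by simp [Consec]; omega
  have c2 : Consec {a, e, f, b} e f := by simp [Consec]; omega
  have c3 : Consec {a, e, f, b} f b := by simp [Consec]; omega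
  have spec : ∀ y ∈ X, _ := fun y hy => h.quadType_spec hae hef hfb hy
  set τ := quadType a e f b
  have t0 : ∀ y ∈ X, τ y = 0 → y.1 = a ∧ e < y.2 ∧ y.2 < f := fun y hy hi => by
    have := spec y hy
    omega
  have t1 : ∀ y ∈ X, τ y = 1 → y.1 = e ∧ f < y.2 ∧ y.2 < b := fun y hy hi => by
    have := spec y hy
    omega
  have t2 : ∀ y ∈ X, τ y = 2 → y.1 = f ∧ (y.2 < a ∨ b < y.2) := fun y hy hi => by
    have := spec y hy
    omega
  have t3 : ∀ y ∈ X, τ y = 3 → y.1 = b ∧ a < y.2 ∧ y.2 < e := fun y hy hi => by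
    have := spec y hy
    omega
  have t4 : ∀ y ∈ X, τ y = 4 → y.1 = a ∧ f < y.2 ∧ y.2 < b := fun y hy hi => by
    have := spec y hy
    omega
  have t5 : ∀ y ∈ X, τ y = 5 → y.1 = e ∧ (y.2 < a ∨ b < y.2) := fun y hy hi => by
    have := spec y hy
    omega
  have t6 : ∀ y ∈ X, τ y = 6 → y.1 = f ∧ a < y.2 ∧ y.2 < e := fun y hy hi => by
    have := spec y hy
    omega
  have t7 : ∀ y ∈ X, τ y = 7 → y.1 = b ∧ e < y.2 ∧ y.2 < f := fun y hy hi => by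
    have := spec y hy
    omega
  set N : ℕ → ℕ := fun i => (X.filter (fun y => τ y = i)).card with hN
  have gap : ∀ (G : Finset (ℕ × ℕ)) (i j : ℕ), i ≠ j → G.card ≤ k →
      (∀ y ∈ X, (τ y = i ∨ τ y = j) → y ∈ G) → N i + N j ≤ k := by
    intro G i j hij hG hsub
    refine le_trans ?_ hG
    rw [hN]
    dsimp only
    rw [← Finset.card_union_of_disjoint]
    · apply Finset.card_le_card
      intro y hy
      simp only [Finset.mem_union, Finset.mem_filter, ← and_or_left] at hy
      exact hsub y hy.1 hy.2
    · exact Finset.disjoint_left.2 fun y hy hy' =>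
        hij ((Finset.mem_filter.1 hy).2.symm.trans (Finset.mem_filter.1 hy').2)
  have key : ∀ (G : Finset (ℕ × ℕ)) (u i j₁ j₂ j₃ j₄ : ℕ), Sparse k X G →
      [j₁, j₂, j₃, j₄].Nodup → (∀ x ∈ X, τ x = i → x ∈ G) →
      (∀ x ∈ X, τ x = i → x.1 = u ∧
        ∀ y ∈ X, (τ y = j₁ ∨ τ y = j₂ ∨ τ y = j₃ ∨ τ y = j₄) → Interleave x y) →
      N i = 0 ∨ (N j₁ + N j₂ + N j₃ + N j₄ + 1 ≤ k ∧
        (N i = 1 ∨ N j₁ + N j₂ + N j₃ + N j₄ + 2 ≤ k)) := by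
    intro G u i j₁ j₂ j₃ j₄ hG hnd hxG hx
    refine h.card_class (S := X.filter (fun y => τ y = i)) (Finset.filter_subset _ _)
      (fun x hxi => ?_) hG (u := u) (fun x hxi => ?_) (fun x hxi => ?_)
    · rw [Finset.mem_filter] at hxi
      exact hxG x hxi.1 hxi.2
    · rw [Finset.mem_filter] at hxi
      exact (hx x hxi.1 hxi.2).1
    · rw [Finset.mem_filter] at hxi
      have := sum_card_type_le_crossers (X := X) (x := x) τ {j₁, j₂, j₃, j₄}
        (fun y hy hyS => (hx x hxi.1 hxi.2).2 y hy (by simpa using hyS))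
      simp only [List.nodup_cons, List.mem_cons, not_or, List.not_mem_nil] at hnd
      rw [Finset.sum_insert (by simp; tauto), Finset.sum_insert (by simp; tauto),
        Finset.sum_insert (by simp; tauto), Finset.sum_singleton] at this
      simp only [hN]
      omega
  have hsum : X.card = ∑ i ∈ Finset.range 8, N i := by
    refine Finset.card_eq_sum_card_fiberwise fun y hy => ?_
    have := spec y hy
    simp only [Finset.coe_range, Set.mem_Iio]
    omega
  have g1 := gap _ 3 6 (by decide) (h.gap_card a e c1) (fun y hy hi => by
    simp only [chordsInto, Finset.mem_filter, hy, true_and]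
    rcases hi with hi | hi
    · exact (t3 y hy hi).2
    · exact (t6 y hy hi).2)
  have g2 := gap _ 0 7 (by decide) (h.gap_card e f c2) (fun y hy hi => by
    simp only [chordsInto, Finset.mem_filter, hy, true_and]
    rcases hi with hi | hi
    · exact (t0 y hy hi).2
    · exact (t7 y hy hi).2)
  have g3 := gap _ 1 4 (by decide) (h.gap_card f b c3) (fun y hy hi => by
    simp only [chordsInto, Finset.mem_filter, hy, true_and]
    rcases hi with hi | hi
    · exact (t1 y hy hi).2
    · exact (t4 y hy hi).2)
  have g4 := gap _ 2 5 (by decide) h.out_card (fun y hy hi => by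
    simp only [chordsOut, Finset.mem_filter, hy, true_and]
    rcases hi with hi | hi
    · exact (t2 y hy hi).2
    · exact (t5 y hy hi).2)
  have a1 := key _ a 0 1 5 6 3 (hin e f c2) (by decide) (fun x hx hi => by
    simp only [chordsInto, Finset.mem_filter, hx, true_and]
    exact (t0 x hx hi).2)
    (fun x hx hi => ⟨(t0 x hx hi).1, fun y hy hj => by
      have := t0 x hx hi
      have := t1 y hy
      have := t5 y hy
      have := t6 y hy
      have := t3 y hy
      unfold Interleave Inside Outside
      rcases hj with hj | hj | hj | hj <;> simp only [hj, forall_const] at * <;> omega⟩)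
  have a2 := key _ e 1 2 6 7 0 (hin f b c3) (by decide) (fun x hx hi => by
    simp only [chordsInto, Finset.mem_filter, hx, true_and]
    exact (t1 x hx hi).2)
    (fun x hx hi => ⟨(t1 x hx hi).1, fun y hy hj => by
      have := t1 x hx hi
      have := t2 y hy
      have := t6 y hy
      have := t7 y hy
      have := t0 y hy
      unfold Interleave Inside Outside
      rcases hj with hj | hj | hj | hj <;> simp only [hj, forall_const] at * <;> omega⟩)
  have a3 := key _ f 2 3 7 4 1 hout (by decide) (fun x hx hi => by
    simp only [chordsOut, Finset.mem_filter, hx, true_and]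
    exact (t2 x hx hi).2)
    (fun x hx hi => ⟨(t2 x hx hi).1, fun y hy hj => by
      have := t2 x hx hi
      have := t3 y hy
      have := t7 y hy
      have := t4 y hy
      have := t1 y hy
      unfold Interleave Inside Outside
      rcases hj with hj | hj | hj | hj <;> simp only [hj, forall_const] at * <;> omega⟩)
  have a4 := key _ b 3 0 4 5 2 (hin a e c1) (by decide) (fun x hx hi => by
    simp only [chordsInto, Finset.mem_filter, hx, true_and]
    exact (t3 x hx hi).2)
    (fun x hx hi => ⟨(t3 x hx hi).1, fun y hy hj => by
      have := t3 x hx hi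
      have := t0 y hy
      have := t4 y hy
      have := t5 y hy
      have := t2 y hy
      unfold Interleave Inside Outside
      rcases hj with hj | hj | hj | hj <;> simp only [hj, forall_const] at * <;> omega⟩)
  have b1 := key _ a 4 2 3 7 5 (hin f b c3) (by decide) (fun x hx hi => by
    simp only [chordsInto, Finset.mem_filter, hx, true_and]
    exact (t4 x hx hi).2)
    (fun x hx hi => ⟨(t4 x hx hi).1, fun y hy hj => by
      have := t4 x hx hi
      have := t2 y hy
      have := t3 y hy
      have := t7 y hy
      have := t5 y hy
      unfold Interleave Inside Outside
      rcases hj with hj | hj | hj | hj <;> simp only [hj, forall_const] at * <;> omega⟩)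
  have b2 := key _ e 5 3 0 4 6 hout (by decide) (fun x hx hi => by
    simp only [chordsOut, Finset.mem_filter, hx, true_and]
    exact (t5 x hx hi).2)
    (fun x hx hi => ⟨(t5 x hx hi).1, fun y hy hj => by
      have := t5 x hx hi
      have := t3 y hy
      have := t0 y hy
      have := t4 y hy
      have := t6 y hy
      unfold Interleave Inside Outside
      rcases hj with hj | hj | hj | hj <;> simp only [hj, forall_const] at * <;> omega⟩)
  have b3 := key _ f 6 0 1 5 7 (hin a e c1) (by decide) (fun x hx hi => by
    simp only [chordsInto, Finset.mem_filter, hx, true_and]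
    exact (t6 x hx hi).2)
    (fun x hx hi => ⟨(t6 x hx hi).1, fun y hy hj => by
      have := t6 x hx hi
      have := t0 y hy
      have := t1 y hy
      have := t5 y hy
      have := t7 y hy
      unfold Interleave Inside Outside
      rcases hj with hj | hj | hj | hj <;> simp only [hj, forall_const] at * <;> omega⟩)
  have b4 := key _ b 7 1 2 6 4 (hin e f c2) (by decide) (fun x hx hi => by
    simp only [chordsInto, Finset.mem_filter, hx, true_and]
    exact (t7 x hx hi).2)
    (fun x hx hi => ⟨(t7 x hx hi).1, fun y hy hj => by
      have := t7 x hx hi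
      have := t1 y hy
      have := t2 y hy
      have := t6 y hy
      have := t4 y hy
      unfold Interleave Inside Outside
      rcases hj with hj | hj | hj | hj <;> simp only [hj, forall_const] at * <;> omega⟩)
  have := quad_arith k _ _ _ _ _ _ _ _ hk g1 g2 g3 g4 a1 a2 a3 a4 b1 b2 b3 b4
  rw [hsum]
  simp only [Finset.sum_range_succ, Finset.sum_range_zero]
  omega

end FaceChords

/-- The unordered pair underlying `x`, written with the smaller entry first. -/
def sortPair (x : ℕ × ℕ) : ℕ × ℕ := (min x.1 x.2, max x.1 x.2)

theorem sortPair_eq (x : ℕ × ℕ) :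
    (sortPair x).1 = x.1 ∧ (sortPair x).2 = x.2 ∨ (sortPair x).1 = x.2 ∧ (sortPair x).2 = x.1 := by
  simp only [sortPair]
  omega

theorem sortPair_of_lt {x : ℕ × ℕ} (h : x.1 < x.2) : sortPair x = x :=
  Prod.ext (min_eq_left h.le) (max_eq_right h.le)

theorem interleave_sortPair_iff (x y : ℕ × ℕ) :
    Interleave (sortPair x) (sortPair y) ↔ Interleave x y := by
  unfold Interleave Inside Outside
  rcases sortPair_eq x with ⟨h1, h2⟩ | ⟨h1, h2⟩ <;>
    rcases sortPair_eq y with ⟨h3, h4⟩ | ⟨h3, h4⟩ <;>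
    rw [h1, h2, h3, h4] <;> omega

theorem interleave_comm (x y : ℕ × ℕ) : Interleave x y ↔ Interleave y x := by
  unfold Interleave Inside Outside
  omega

/-- The chord from `v` to `w` leaves `v` into the region spanned by `a, …, b`. -/
def Half (a b v w : ℕ) : Prop :=
  (a < v ∧ v < b) ∨ (a = v ∧ v < w ∧ w < b) ∨ (a < w ∧ w < v ∧ v = b)

/-- A maximum noncrossing subset `H` of the edges `E` of a graph on `0, …, N`, together with its
union `P` with the boundary of the convex hull. -/
structure Skeleton (k N : ℕ) (E H P : Finset (ℕ × ℕ)) : Prop where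
  pos : 0 < N
  lt : ∀ e ∈ E, e.1 < e.2
  le : ∀ e ∈ E, e.2 ≤ N
  crossers_le : ∀ e ∈ E, (crossers E e).card ≤ k
  subset : H ⊆ E
  mem_iff : ∀ f, f ∈ P ↔ f ∈ H ∨ (f.2 = f.1 + 1 ∧ f.2 ≤ N) ∨ f = (0, N)
  noncrossing : ∀ f ∈ P, ∀ g ∈ P, ¬ Interleave f g
  exists_crosser : ∀ f ∈ E \ H, ∃ g ∈ H, Interleave f g
  exchange : ∀ f ∈ E \ H, ∀ f' ∈ E \ H, f ≠ f' → ¬ Interleave f f' → ∀ g ∈ H,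
    Interleave f g → Interleave f' g → 2 ≤ (crossers H f).card ∨ 2 ≤ (crossers H f').card

/-- The inner vertices of the face of `P` below the edge `(a, b)`. -/
noncomputable def innerVerts (P : Finset (ℕ × ℕ)) (a b : ℕ) : Finset ℕ :=
  (Finset.Ioo a b).filter (fun v => ∀ g ∈ P, g.1 < v → v < g.2 → g.1 ≤ a ∧ b ≤ g.2)

/-- The vertices of the face of `P` below the edge `(a, b)`. -/
noncomputable def faceVerts (P : Finset (ℕ × ℕ)) (a b : ℕ) : Finset ℕ :=
  insert a (insert b (innerVerts P a b))

/-- The edges of `H` other than `(a, b)` on the face of `P` below `(a, b)`. -/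
noncomputable def faceEdges (H P : Finset (ℕ × ℕ)) (a b : ℕ) : Finset (ℕ × ℕ) :=
  H.filter (fun g => g ≠ (a, b) ∧ a ≤ g.1 ∧ g.2 ≤ b ∧
    ∀ g' ∈ P, g'.1 ≤ g.1 → g.2 ≤ g'.2 → g' ≠ g → g'.1 ≤ a ∧ b ≤ g'.2)

/-- The orientations of the edges in `E` but not in `H` that start inside the face of `P`
below `(a, b)`. -/
noncomputable def faceChords (N : ℕ) (E H P : Finset (ℕ × ℕ)) (a b : ℕ) : Finset (ℕ × ℕ) :=
  (Finset.range (N + 1) ×ˢ Finset.range (N + 1)).filter (fun x => sortPair x ∈ E \ H ∧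
    Half a b x.1 x.2 ∧ ∀ g ∈ P, Half g.1 g.2 x.1 x.2 → g.1 ≤ a ∧ b ≤ g.2)

namespace Skeleton

variable {k N : ℕ} {E H P : Finset (ℕ × ℕ)} {a b : ℕ}

theorem lt_of_mem (h : Skeleton k N E H P) {f : ℕ × ℕ} (hf : f ∈ P) : f.1 < f.2 := by
  rcases (h.mem_iff f).1 hf with hf | hf | rfl
  · exact h.lt f (h.subset hf)
  · omega
  · exact h.pos

theorem le_of_mem (h : Skeleton k N E H P) {f : ℕ × ℕ} (hf : f ∈ P) : f.2 ≤ N := by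
  rcases (h.mem_iff f).1 hf with hf | hf | rfl
  · exact h.le f (h.subset hf)
  · exact hf.2
  · exact le_rfl

theorem mem_of_mem_edges (h : Skeleton k N E H P) {f : ℕ × ℕ} (hf : f ∈ H) : f ∈ P :=
  (h.mem_iff f).2 (Or.inl hf)

theorem root_mem (h : Skeleton k N E H P) : (0, N) ∈ P :=
  (h.mem_iff _).2 (Or.inr (Or.inr rfl))

theorem nested (h : Skeleton k N E H P) {f g : ℕ × ℕ} (hf : f ∈ P) (hg : g ∈ P) :
    f.2 ≤ g.1 ∨ g.2 ≤ f.1 ∨ (f.1 ≤ g.1 ∧ g.2 ≤ f.2) ∨ (g.1 ≤ f.1 ∧ f.2 ≤ g.2) := by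
  have h1 := h.noncrossing f hf g hg
  have h2 := h.lt_of_mem hf
  have h3 := h.lt_of_mem hg
  unfold Interleave Inside Outside at h1
  omega

theorem mem_innerVerts {v : ℕ} : v ∈ innerVerts P a b ↔
    a < v ∧ v < b ∧ ∀ g ∈ P, g.1 < v → v < g.2 → g.1 ≤ a ∧ b ≤ g.2 := by
  simp [innerVerts, and_assoc]

theorem mem_faceVerts {v : ℕ} : v ∈ faceVerts P a b ↔
    v = a ∨ v = b ∨ v ∈ innerVerts P a b := by
  simp [faceVerts]

theorem card_faceVerts (hab : a < b) :
    (faceVerts P a b).card = (innerVerts P a b).card + 2 := by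
  rw [faceVerts, Finset.card_insert_of_notMem, Finset.card_insert_of_notMem]
  · simp [mem_innerVerts]
  · simp [mem_innerVerts, hab.ne]

theorem le_of_mem_faceVerts (hab : a < b) {v : ℕ} (hv : v ∈ faceVerts P a b) :
    a ≤ v ∧ v ≤ b := by
  rcases mem_faceVerts.1 hv with rfl | rfl | hv
  · omega
  · omega
  · have := mem_innerVerts.1 hv
    omega

theorem mem_faceVerts_of_forall (hab : a ≤ b) {v : ℕ} (ha : a ≤ v) (hb : v ≤ b)
    (hv : a < v → v < b → ∀ g ∈ P, g.1 < v → v < g.2 → g.1 ≤ a ∧ b ≤ g.2) :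
    v ∈ faceVerts P a b := by
  rw [mem_faceVerts, mem_innerVerts]
  rcases ha.eq_or_lt with rfl | ha
  · exact Or.inl rfl
  rcases hb.eq_or_lt with rfl | hb
  · exact Or.inr (Or.inl rfl)
  · exact Or.inr (Or.inr ⟨ha, hb, hv ha hb⟩)

/-- An edge of `P` passing above a vertex of the face below `(a, b)` encloses `(a, b)`. -/
theorem encloses_of_mem_faceVerts (h : Skeleton k N E H P) (hab : (a, b) ∈ P) {v : ℕ}
    (hv : v ∈ faceVerts P a b) {g : ℕ × ℕ} (hg : g ∈ P) (h1 : g.1 < v) (h2 : v < g.2) :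
    g.1 ≤ a ∧ b ≤ g.2 := by
  have hn := h.nested hg hab
  have := h.lt_of_mem hab
  dsimp only at hn this
  rcases mem_faceVerts.1 hv with rfl | rfl | hv
  · omega
  · omega
  · exact (mem_innerVerts.1 hv).2.2 g hg h1 h2

theorem exists_next (h : Skeleton k N E H P) (hab : (a, b) ∈ P) (hab2 : a + 2 ≤ b) {p : ℕ}
    (hp : p ∈ faceVerts P a b) (hpb : p < b) :
    ∃ d, Consec (faceVerts P a b) p d ∧ (p, d) ∈ P ∧ (p, d) ≠ (a, b) := by
  have hpa := (le_of_mem_faceVerts (by omega) hp).1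
  have hbN := h.le_of_mem hab
  have hne : ((Finset.range (b + 1)).filter
      (fun d => p < d ∧ (p, d) ∈ P ∧ (p, d) ≠ (a, b))).Nonempty := by
    refine ⟨p + 1, Finset.mem_filter.2 ⟨Finset.mem_range.2 (by omega), by omega, ?_, ?_⟩⟩
    · exact (h.mem_iff _).2 (Or.inr (Or.inl ⟨rfl, by dsimp only at *; omega⟩))
    · rw [Ne, Prod.mk.injEq]
      omega
  obtain ⟨d, hd, hmax⟩ := Finset.exists_max_image _ id hne
  simp only [Finset.mem_filter, Finset.mem_range, id] at hd hmax
  obtain ⟨hdb, hpd, hP, hne'⟩ := hd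
  refine ⟨d, ⟨hp, ?_, hpd, ?_⟩, hP, hne'⟩
  · refine mem_faceVerts_of_forall (by omega) (by omega) (by omega) fun _ hdb' g hg h1 h2 => ?_
    have hn := h.nested hg hP
    have hn' := h.nested hg hab
    dsimp only at hn hn'
    rcases lt_or_ge g.1 p with hgp | hgp
    · exact h.encloses_of_mem_faceVerts hab hp hg hgp (by omega)
    · have hgp' : g.1 = p := by omega
      have := hmax g.2
      rw [← hgp', Ne, Prod.mk.injEq] at this
      by_contra hcon
      have := this ⟨by omega, by omega, hg, by omega⟩
      omega
  · rintro u hu ⟨hu1, hu2⟩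
    have := h.encloses_of_mem_faceVerts hab hu hP hu1 hu2
    rw [Ne, Prod.mk.injEq] at hne'
    dsimp only at this
    omega

theorem mem_of_consec (h : Skeleton k N E H P) (hab : (a, b) ∈ P) (hab2 : a + 2 ≤ b) {p q : ℕ}
    (hpq : Consec (faceVerts P a b) p q) : (p, q) ∈ P ∧ (p, q) ≠ (a, b) := by
  have := (le_of_mem_faceVerts (by omega) hpq.2.1).2
  obtain ⟨d, hd, hP⟩ := h.exists_next hab hab2 hpq.1 (by have := hpq.2.2.1; omega)
  have h1 := hpq.2.2.2 d hd.2.1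
  have h2 := hd.2.2.2 q hpq.2.1
  have h3 := hd.2.2.1
  have h4 := hpq.2.2.1
  obtain rfl : d = q := by omega
  exact hP

theorem mem_faceChords {x : ℕ × ℕ} (h : Skeleton k N E H P) :
    x ∈ faceChords N E H P a b ↔ sortPair x ∈ E \ H ∧ Half a b x.1 x.2 ∧
      ∀ g ∈ P, Half g.1 g.2 x.1 x.2 → g.1 ≤ a ∧ b ≤ g.2 := by
  simp only [faceChords, Finset.mem_filter, Finset.mem_product, Finset.mem_range,
    and_iff_right_iff_imp]
  intro hx
  have h1 := h.lt _ (Finset.mem_sdiff.1 hx.1).1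
  have h2 := h.le _ (Finset.mem_sdiff.1 hx.1).1
  have := sortPair_eq x
  omega

theorem fst_mem (h : Skeleton k N E H P) (hab : (a, b) ∈ P) {x : ℕ × ℕ}
    (hx : x ∈ faceChords N E H P a b) : x.1 ∈ faceVerts P a b := by
  obtain ⟨-, h2, h3⟩ := h.mem_faceChords.1 hx
  have := h.lt_of_mem hab
  unfold Half at h2
  refine mem_faceVerts_of_forall this.le (by omega) (by omega) fun _ _ g hg h4 h5 => ?_
  exact h3 g hg (Or.inl ⟨h4, h5⟩)

theorem snd_notMem (h : Skeleton k N E H P) (hab : (a, b) ∈ P) {x : ℕ × ℕ}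
    (hx : x ∈ faceChords N E H P a b) : x.2 ∉ faceVerts P a b := by
  intro hw
  obtain ⟨g, hg, hxg⟩ := h.exists_crosser _ (h.mem_faceChords.1 hx).1
  have hgP := h.mem_of_mem_edges hg
  have hlt := h.lt_of_mem hgP
  rw [← sortPair_of_lt hlt, interleave_sortPair_iff] at hxg
  have h1 := h.encloses_of_mem_faceVerts hab (h.fst_mem hab hx) hgP
  have h2 := h.encloses_of_mem_faceVerts hab hw hgP
  have h3 := le_of_mem_faceVerts (h.lt_of_mem hab) (h.fst_mem hab hx)
  have h4 := le_of_mem_faceVerts (h.lt_of_mem hab) hw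
  unfold Interleave Inside Outside at hxg
  dsimp only at h3 h4
  omega

theorem sortPair_injOn (h : Skeleton k N E H P) (hab : (a, b) ∈ P) {x y : ℕ × ℕ}
    (hx : x ∈ faceChords N E H P a b) (hy : y ∈ faceChords N E H P a b)
    (hxy : sortPair x = sortPair y) : x = y := by
  have h1 := h.fst_mem hab hx
  have h2 := h.snd_notMem hab hy
  have hne : x.1 ≠ y.2 := fun hc => h2 (hc ▸ h1)
  have h3 := sortPair_eq x
  have h4 := sortPair_eq y
  rw [hxy] at h3
  exact Prod.ext (by omega) (by omega)

theorem card_crossers_add_le (h : Skeleton k N E H P) (hab : (a, b) ∈ P) {x : ℕ × ℕ}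
    (hx : x ∈ faceChords N E H P a b) :
    (crossers (faceChords N E H P a b) x).card + (crossers H (sortPair x)).card ≤ k := by
  have hxE := (h.mem_faceChords.1 hx).1
  refine le_trans ?_ (h.crossers_le _ (Finset.mem_sdiff.1 hxE).1)
  rw [← Finset.card_image_of_injOn (f := sortPair) (s := crossers (faceChords N E H P a b) x)
    fun y hy z hz => h.sortPair_injOn hab (Finset.mem_filter.1 hy).1 (Finset.mem_filter.1 hz).1,
    ← Finset.card_union_of_disjoint]
  · apply Finset.card_le_card
    intro y hy
    simp only [crossers, Finset.mem_union, Finset.mem_image, Finset.mem_filter] at hy ⊢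
    rcases hy with ⟨z, ⟨hz, hxz⟩, rfl⟩ | ⟨hy, hxy⟩
    · exact ⟨(Finset.mem_sdiff.1 (h.mem_faceChords.1 hz).1).1, (interleave_sortPair_iff _ _).2 hxz⟩
    · exact ⟨h.subset hy, hxy⟩
  · rw [Finset.disjoint_left]
    intro y hy hyH
    simp only [crossers, Finset.mem_image, Finset.mem_filter] at hy hyH
    obtain ⟨z, ⟨hz, -⟩, rfl⟩ := hy
    exact (Finset.mem_sdiff.1 (h.mem_faceChords.1 hz).1).2 hyH.1

/-- Chords of a face leaving through the same edge of `H`. -/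
theorem card_le_and_sparse (h : Skeleton k N E H P) (hab : (a, b) ∈ P) {S : Finset (ℕ × ℕ)}
    (hS : S ⊆ faceChords N E H P a b) {g : ℕ × ℕ}
    (hg : g ∈ H ∨ S = ∅) (hSg : ∀ x ∈ S, Interleave x g) :
    S.card ≤ k ∧ Sparse k (faceChords N E H P a b) S := by
  rcases hg with hg | rfl
  swap
  · exact ⟨by simp, by simp [Sparse]⟩
  have hlt := h.lt_of_mem (h.mem_of_mem_edges hg)
  constructor
  · refine le_trans ?_ (h.crossers_le g (h.subset hg))
    rw [← Finset.card_image_of_injOn (f := sortPair) (s := S)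
      fun y hy z hz => h.sortPair_injOn hab (hS hy) (hS hz)]
    apply Finset.card_le_card
    intro y hy
    obtain ⟨z, hz, rfl⟩ := Finset.mem_image.1 hy
    refine Finset.mem_filter.2 ⟨(Finset.mem_sdiff.1 (h.mem_faceChords.1 (hS hz)).1).1, ?_⟩
    rw [← sortPair_of_lt hlt, interleave_sortPair_iff, interleave_comm]
    exact hSg z hz
  · intro x hx y hy hxy hxy1
    have h1 := h.card_crossers_add_le hab (hS hx)
    have h2 := h.card_crossers_add_le hab (hS hy)
    have h3 := h.exchange _ (h.mem_faceChords.1 (hS hx)).1 _ (h.mem_faceChords.1 (hS hy)).1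
      (fun hc => hxy (h.sortPair_injOn hab (hS hx) (hS hy) hc))
      (by
        rw [interleave_sortPair_iff]
        unfold Interleave Inside Outside
        omega) g hg
      (by
        rw [← sortPair_of_lt hlt, interleave_sortPair_iff]
        exact hSg x hx)
      (by
        rw [← sortPair_of_lt hlt, interleave_sortPair_iff]
        exact hSg y hy)
    omega

theorem chordsInto_spec (h : Skeleton k N E H P) (hab : (a, b) ∈ P) (hab2 : a + 2 ≤ b) {p q : ℕ}
    (hpq : Consec (faceVerts P a b) p q) :
    (chordsInto (faceChords N E H P a b) p q).card ≤ k ∧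
      Sparse k (faceChords N E H P a b) (chordsInto (faceChords N E H P a b) p q) := by
  have hP := h.mem_of_consec hab hab2 hpq
  have hp := le_of_mem_faceVerts (by omega) hpq.1
  have hq := le_of_mem_faceVerts (by omega) hpq.2.1
  have hlt := hpq.2.2.1
  have hbN := h.le_of_mem hab
  have hne := hP.2
  rw [Ne, Prod.mk.injEq] at hne
  refine h.card_le_and_sparse hab (Finset.filter_subset _ _) (g := (p, q)) ?_ fun x hx => ?_
  · rcases (h.mem_iff _).1 hP.1 with hH | hH | hH
    · exact Or.inl hH
    · right
      simp only [chordsInto, Finset.filter_eq_empty_iff]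
      dsimp only at hH
      omega
    · rw [Prod.mk.injEq] at hH
      dsimp only at hbN
      omega
  · simp only [chordsInto, Finset.mem_filter] at hx
    have h1 := (h.mem_faceChords.1 hx.1).2.2 _ hP.1
    have h2 := hpq.2.2.2 _ (h.fst_mem hab hx.1)
    unfold Half at h1
    unfold Interleave Inside Outside
    dsimp only at *
    omega

theorem chordsOut_spec (h : Skeleton k N E H P) (hab : (a, b) ∈ P) (hab2 : a + 2 ≤ b) :
    (chordsOut (faceChords N E H P a b) a b).card ≤ k ∧
      Sparse k (faceChords N E H P a b) (chordsOut (faceChords N E H P a b) a b) := by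
  refine h.card_le_and_sparse hab (Finset.filter_subset _ _) (g := (a, b)) ?_ fun x hx => ?_
  · rcases (h.mem_iff _).1 hab with hH | hH | hH
    · exact Or.inl hH
    · dsimp only at hH
      omega
    · right
      rw [Prod.mk.injEq] at hH
      simp only [chordsOut, Finset.filter_eq_empty_iff]
      intro x hx
      have h1 := h.le _ (Finset.mem_sdiff.1 (h.mem_faceChords.1 hx).1).1
      have h2 := h.lt _ (Finset.mem_sdiff.1 (h.mem_faceChords.1 hx).1).1
      have h3 := sortPair_eq x
      omega
  · simp only [chordsOut, Finset.mem_filter] at hx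
    have h1 := (h.mem_faceChords.1 hx.1).2.1
    unfold Half at h1
    unfold Interleave Inside Outside
    dsimp only
    omega

theorem faceChords_spec (h : Skeleton k N E H P) (hab : (a, b) ∈ P) (hab2 : a + 2 ≤ b) :
    FaceChords k (faceVerts P a b) a b (faceChords N E H P a b) where
  ha := by simp [faceVerts]
  hb := by simp [faceVerts]
  hab := by omega
  hU := fun u hu => le_of_mem_faceVerts (by omega) hu
  src := fun x hx => h.fst_mem hab hx
  tgt := fun x hx => h.snd_notMem hab hx
  inner := fun x hx h1 h2 => by
    have hv := h.fst_mem hab hx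
    have hw := h.snd_notMem hab hx
    have hvab := le_of_mem_faceVerts (by omega) hv
    have hmin := (h.mem_faceChords.1 hx).2.2
    unfold Half at hmin
    rcases lt_trichotomy x.1 x.2 with hlt | heq | hgt
    · obtain ⟨q, hq⟩ := Consec.exists_succ hv (b := b) (by simp [faceVerts]) (by omega)
      have hP := h.mem_of_consec hab hab2 hq
      have h3 := hmin _ hP.1
      have hne := hP.2
      have h4 : q ≠ x.2 := fun hc => hw (hc ▸ hq.2.1)
      have h5 := hq.2.2.1
      have h6 := le_of_mem_faceVerts (by omega) hq.2.1
      rw [Ne, Prod.mk.injEq] at hne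
      dsimp only at h3
      refine ⟨q, hq.2.1, ?_⟩
      unfold Inside
      omega
    · exact absurd (heq ▸ hv) hw
    · obtain ⟨q, hq⟩ := Consec.exists_pred hv (a := a) (by simp [faceVerts]) (by omega)
      have hP := h.mem_of_consec hab hab2 hq
      have h3 := hmin _ hP.1
      have hne := hP.2
      have h4 : q ≠ x.2 := fun hc => hw (hc ▸ hq.1)
      have h5 := hq.2.2.1
      have h6 := le_of_mem_faceVerts (by omega) hq.1
      rw [Ne, Prod.mk.injEq] at hne
      dsimp only at h3
      refine ⟨q, hq.1, ?_⟩
      unfold Inside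
      omega
  outer := fun x hx h1 => by
    have h2 := (h.mem_faceChords.1 hx).2.1
    unfold Half at h2
    omega
  cross := fun x hx => by
    have h1 := h.card_crossers_add_le hab hx
    obtain ⟨g, hg, hxg⟩ := h.exists_crosser _ (h.mem_faceChords.1 hx).1
    have h2 : 0 < (crossers H (sortPair x)).card :=
      Finset.card_pos.2 ⟨g, Finset.mem_filter.2 ⟨hg, hxg⟩⟩
    omega
  out_card := (h.chordsOut_spec hab hab2).1
  gap_card := fun p q hpq => (h.chordsInto_spec hab hab2 hpq).1
  gap_sparse := fun p q hpq => Or.inr (h.chordsInto_spec hab hab2 hpq).2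

end Skeleton

theorem even_card_of_consec_ne {U : Finset ℕ} {a : ℕ} {c : ℕ → Prop} (ha : a ∈ U)
    (hU : ∀ u ∈ U, a ≤ u) (hc : ∀ p q, Consec U p q → ¬ (c p ↔ c q)) (p : ℕ) (hp : p ∈ U) :
    (c p ↔ c a) ↔ Even (U.filter (· < p)).card := by
  induction p using Nat.strong_induction_on with
  | _ p ih =>
    rcases (hU p hp).eq_or_lt with rfl | hlt
    · have : U.filter (· < a) = ∅ := Finset.filter_eq_empty_iff.2 fun u hu => (hU u hu).not_gt
      simp [this]
    · obtain ⟨q, hq⟩ := Consec.exists_pred hp ha hlt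
      have hU' : U.filter (· < p) = insert q (U.filter (· < q)) := by
        ext u
        have h1 := hq.2.2.1
        have h2 := hq.2.2.2 u
        have h3 := hq.1
        simp only [Finset.mem_filter, Finset.mem_insert]
        constructor
        · rintro ⟨hu, hup⟩
          have := h2 hu
          rcases eq_or_ne u q with h | h
          · exact Or.inl h
          · exact Or.inr ⟨hu, by omega⟩
        · rintro (rfl | ⟨hu, huq⟩)
          · exact ⟨h3, h1⟩
          · exact ⟨hu, by omega⟩
      rw [hU', Finset.card_insert_of_notMem (by simp), Nat.even_add_one, ← ih q hq.2.2.1 hq.1]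
      have := hc q p hq
      tauto

namespace Skeleton

variable {k N : ℕ} {E H P : Finset (ℕ × ℕ)} {a b : ℕ}

theorem consec_of_mem_faceEdges (h : Skeleton k N E H P) (hab : (a, b) ∈ P) {g : ℕ × ℕ}
    (hg : g ∈ faceEdges H P a b) : Consec (faceVerts P a b) g.1 g.2 := by
  simp only [faceEdges, Finset.mem_filter] at hg
  obtain ⟨hgH, hne, hga, hgb, hmin⟩ := hg
  have hgP := h.mem_of_mem_edges hgH
  have hlt := h.lt_of_mem hgP
  have hlt' := h.lt_of_mem hab
  rw [Ne, Prod.ext_iff] at hne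
  dsimp only at hne hlt'
  refine ⟨?_, ?_, hlt, ?_⟩
  · refine mem_faceVerts_of_forall (by omega) (by omega) (by omega) fun _ _ g' hg' h1 h2 => ?_
    have := h.nested hg' hgP
    exact hmin g' hg' (by omega) (by omega) (by rintro rfl; omega)
  · refine mem_faceVerts_of_forall (by omega) (by omega) (by omega) fun _ _ g' hg' h1 h2 => ?_
    have := h.nested hg' hgP
    exact hmin g' hg' (by omega) (by omega) (by rintro rfl; omega)
  · rintro u hu ⟨h1, h2⟩
    have := h.encloses_of_mem_faceVerts hab hu hgP h1 h2
    omega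

theorem fst_injOn_faceEdges (h : Skeleton k N E H P) (hab : (a, b) ∈ P) :
    Set.InjOn Prod.fst (faceEdges H P a b : Set (ℕ × ℕ)) := by
  intro x hx y hy hxy
  have h1 := h.consec_of_mem_faceEdges hab hx
  have h2 := h.consec_of_mem_faceEdges hab hy
  have h3 := h1.2.2.2 _ h2.2.1
  have h4 := h2.2.2.2 _ h1.2.1
  have h5 := h1.2.2.1
  have h6 := h2.2.2.1
  exact Prod.ext hxy (by omega)

theorem image_fst_faceEdges (h : Skeleton k N E H P) (hab : (a, b) ∈ P) :
    (faceEdges H P a b).image Prod.fst ⊆ (faceVerts P a b).erase b := by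
  intro p hp
  obtain ⟨g, hg, rfl⟩ := Finset.mem_image.1 hp
  have h1 := h.consec_of_mem_faceEdges hab hg
  have h2 := (le_of_mem_faceVerts (h.lt_of_mem hab) h1.2.1).2
  have h3 := h1.2.2.1
  exact Finset.mem_erase.2 ⟨by omega, h1.1⟩

theorem card_erase_faceVerts (hab : a < b) :
    ((faceVerts P a b).erase b).card = (innerVerts P a b).card + 1 := by
  rw [Finset.card_erase_of_mem (by simp [faceVerts]), card_faceVerts hab]
  rfl

theorem card_faceEdges_le (h : Skeleton k N E H P) (hab : (a, b) ∈ P) :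
    (faceEdges H P a b).card ≤ (innerVerts P a b).card + 1 := by
  rw [← card_erase_faceVerts (h.lt_of_mem hab),
    ← Finset.card_image_of_injOn (h.fst_injOn_faceEdges hab)]
  exact Finset.card_le_card (h.image_fst_faceEdges hab)

theorem mem_faceEdges_of_consec (h : Skeleton k N E H P) (hab : (a, b) ∈ P)
    (hcard : (faceEdges H P a b).card = (innerVerts P a b).card + 1) {p q : ℕ}
    (hpq : Consec (faceVerts P a b) p q) : (p, q) ∈ faceEdges H P a b := by
  have himg := Finset.eq_of_subset_of_card_le (h.image_fst_faceEdges hab)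
    (by rw [card_erase_faceVerts (h.lt_of_mem hab),
      Finset.card_image_of_injOn (h.fst_injOn_faceEdges hab), hcard])
  have hqb := (le_of_mem_faceVerts (h.lt_of_mem hab) hpq.2.1).2
  have hp : p ∈ (faceEdges H P a b).image Prod.fst := by
    rw [himg, Finset.mem_erase]
    have := hpq.2.2.1
    exact ⟨by omega, hpq.1⟩
  obtain ⟨g, hg, rfl⟩ := Finset.mem_image.1 hp
  have h1 := h.consec_of_mem_faceEdges hab hg
  have h2 := hpq.2.2.2 _ h1.2.1
  have h3 := h1.2.2.2 _ hpq.2.1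
  have h4 := hpq.2.2.1
  have h5 := h1.2.2.1
  obtain rfl : q = g.2 := by omega
  exact hg

theorem even_card_innerVerts (h : Skeleton k N E H P) (c : ℕ → Prop)
    (hc : ∀ e ∈ E, ¬ (c e.1 ↔ c e.2)) (hab : (a, b) ∈ H)
    (hcard : (faceEdges H P a b).card = (innerVerts P a b).card + 1) :
    Even (innerVerts P a b).card := by
  have habP := h.mem_of_mem_edges hab
  have hlt := h.lt_of_mem habP
  have hb := even_card_of_consec_ne (U := faceVerts P a b) (a := a) (c := c) (by simp [faceVerts])
    (fun u hu => (le_of_mem_faceVerts hlt hu).1)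
    (fun p q hpq => hc (p, q) (h.subset
      (Finset.mem_filter.1 (h.mem_faceEdges_of_consec habP hcard hpq)).1))
    b (by simp [faceVerts])
  have hfilter : (faceVerts P a b).filter (· < b) = (faceVerts P a b).erase b := by
    ext u
    rw [Finset.mem_filter, Finset.mem_erase]
    constructor
    · exact fun hu => ⟨hu.2.ne, hu.1⟩
    · exact fun hu => ⟨hu.2, lt_of_le_of_ne (le_of_mem_faceVerts hlt hu.2).2 hu.1⟩
  rw [hfilter, card_erase_faceVerts hlt, Nat.even_add_one] at hb
  have := hc _ (h.subset hab)
  dsimp only at this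
  tauto

theorem card_faceChords_quad (h : Skeleton k N E H P) (hk : k ≤ 4) (hab : (a, b) ∈ P)
    (hcard : (innerVerts P a b).card = 2) : (faceChords N E H P a b).card ≤ 2 * k + 1 := by
  obtain ⟨e, f, hef, hin⟩ : ∃ e f, e < f ∧ innerVerts P a b = {e, f} := by
    obtain ⟨x, y, hxy, hin⟩ := Finset.card_eq_two.1 hcard
    rcases hxy.lt_or_gt with hlt | hlt
    · exact ⟨x, y, hlt, hin⟩
    · exact ⟨y, x, hlt, hin.trans (Finset.pair_comm x y)⟩
  have he : e ∈ innerVerts P a b := by simp [hin]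
  have hf : f ∈ innerVerts P a b := by simp [hin]
  have he' := mem_innerVerts.1 he
  have hf' := mem_innerVerts.1 hf
  have hU : faceVerts P a b = {a, e, f, b} := by
    rw [faceVerts, hin]
    ext u
    simp only [Finset.mem_insert, Finset.mem_singleton]
    tauto
  have hspec := h.faceChords_spec hab (by omega)
  have hgap := fun p q => h.chordsInto_spec hab (p := p) (q := q) (by omega)
  rw [hU] at hspec hgap
  exact hspec.card_quad_le hk he'.1 hef hf'.2.1 (fun p q hpq => (hgap p q hpq).2)
    (h.chordsOut_spec hab (by omega)).2

theorem face_le (h : Skeleton k N E H P) (hk : k ≤ 4) (c : ℕ → Prop)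
    (hc : ∀ e ∈ E, ¬ (c e.1 ↔ c e.2)) (hab : (a, b) ∈ P) :
    4 * (faceEdges H P a b).card + 2 * (faceChords N E H P a b).card ≤
      (2 * k + 7) * (innerVerts P a b).card +
        if (0, N) ∉ H ∧ (a, b) = (0, N) then 4 else 0 := by
  have hlt : a < b := h.lt_of_mem hab
  rcases Nat.lt_or_ge b (a + 2) with hb | hab2
  · have hL : faceEdges H P a b = ∅ := by
      refine Finset.filter_eq_empty_iff.2 fun g hg hg' => hg'.1 ?_
      have := h.lt_of_mem (h.mem_of_mem_edges hg)
      exact Prod.ext (by dsimp only; omega) (by dsimp only; omega)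
    have hX : faceChords N E H P a b = ∅ := by
      refine Finset.filter_eq_empty_iff.2 fun g _ hg' => ?_
      have := hg'.2.1
      unfold Half at this
      omega
    simp [hL, hX]
  have hX := (h.faceChords_spec hab hab2).card_le hk
  rw [card_faceVerts hlt, Nat.add_sub_cancel] at hX
  have hL := h.card_faceEdges_le hab
  have hX' : (faceChords N E H P a b).card ≤ k * (innerVerts P a b).card +
      (innerVerts P a b).card := by linarith
  have hmul : (2 * k + 7) * (innerVerts P a b).card =
      2 * (k * (innerVerts P a b).card) + 7 * (innerVerts P a b).card := by ring
  rw [hmul]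
  by_cases hH : (a, b) ∈ H
  swap
  · have hroot : (a, b) = (0, N) := by
      rcases (h.mem_iff _).1 hab with hab | hab | hab
      · exact absurd hab hH
      · dsimp only at hab
        omega
      · exact hab
    rw [if_pos ⟨hroot ▸ hH, hroot⟩]
    omega
  refine le_add_right ?_
  rcases Nat.lt_or_ge (faceEdges H P a b).card ((innerVerts P a b).card + 1) with hlt' | hge
  · omega
  have hcard := le_antisymm hL hge
  obtain ⟨m, hm⟩ := h.even_card_innerVerts c hc hH hcard
  have h0 : (innerVerts P a b).card ≠ 0 := by
    intro h0
    have hU : faceVerts P a b = {a, b} := by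
      rw [faceVerts, Finset.card_eq_zero.1 h0]
      rfl
    have hcon : Consec (faceVerts P a b) a b := by
      rw [hU]
      refine ⟨by simp, by simp, hlt, fun u hu => ?_⟩
      simp only [Finset.mem_insert, Finset.mem_singleton] at hu
      omega
    exact (Finset.mem_filter.1 (h.mem_faceEdges_of_consec hab hcard hcon)).2.1 rfl
  rcases eq_or_ne (innerVerts P a b).card 2 with h2 | h2
  · have := h.card_faceChords_quad hk hab h2
    rw [h2] at hcard ⊢
    omega
  · omega

theorem sum_card_innerVerts_le (h : Skeleton k N E H P) :
    ∑ g ∈ P, (innerVerts P g.1 g.2).card + 1 ≤ N := by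
  rw [← Finset.card_biUnion]
  · have : (P.biUnion fun g => innerVerts P g.1 g.2) ⊆ Finset.Ioo 0 N := by
      intro v hv
      obtain ⟨g, hg, hv⟩ := Finset.mem_biUnion.1 hv
      have h1 := mem_innerVerts.1 hv
      have h2 := h.le_of_mem hg
      exact Finset.mem_Ioo.2 ⟨by omega, by omega⟩
    have := Finset.card_le_card this
    rw [Nat.card_Ioo] at this
    have := h.pos
    omega
  · intro g hg g' hg' hne
    refine Finset.disjoint_left.2 fun v hv hv' => hne ?_
    have h1 := mem_innerVerts.1 hv
    have h2 := mem_innerVerts.1 hv'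
    have h3 := h1.2.2 g' hg' h2.1 h2.2.1
    have h4 := h2.2.2 g hg h1.1 h1.2.1
    exact Prod.ext (by omega) (by omega)

theorem card_edges_le_sum (h : Skeleton k N E H P) :
    H.card ≤ ∑ g ∈ P, (faceEdges H P g.1 g.2).card + if (0, N) ∈ H then 1 else 0 := by
  have hcover : H.erase (0, N) ⊆ P.biUnion fun g => faceEdges H P g.1 g.2 := by
    intro e he
    obtain ⟨hne, he⟩ := Finset.mem_erase.1 he
    have hlt := h.lt_of_mem (h.mem_of_mem_edges he)
    have hle := h.le_of_mem (h.mem_of_mem_edges he)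
    obtain ⟨g, hg, hmin⟩ := Finset.exists_min_image
      (P.filter fun g => g ≠ e ∧ g.1 ≤ e.1 ∧ e.2 ≤ g.2) (fun g => g.2 - g.1)
      ⟨(0, N), Finset.mem_filter.2 ⟨h.root_mem, hne.symm, Nat.zero_le _, hle⟩⟩
    simp only [Finset.mem_filter] at hg hmin
    refine Finset.mem_biUnion.2 ⟨g, hg.1, Finset.mem_filter.2
      ⟨he, hg.2.1.symm, hg.2.2.1, hg.2.2.2, fun g' hg' h1 h2 h3 => ?_⟩⟩
    have h4 := hmin g' ⟨hg', h3, h1, h2⟩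
    have h5 := h.nested hg' hg.1
    omega
  have h1 := (Finset.card_le_card hcover).trans Finset.card_biUnion_le
  split_ifs with hr
  · rw [Finset.card_erase_of_mem hr] at h1
    omega
  · rw [Finset.erase_eq_of_notMem hr] at h1
    omega

theorem two_mul_card_le_sum (h : Skeleton k N E H P) :
    2 * (E \ H).card ≤ ∑ g ∈ P, (faceChords N E H P g.1 g.2).card := by
  have hcover : ∀ x, sortPair x ∈ E \ H → x ∈ P.biUnion fun g => faceChords N E H P g.1 g.2 := by
    intro x hx
    have hlt := h.lt _ (Finset.mem_sdiff.1 hx).1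
    have hle := h.le _ (Finset.mem_sdiff.1 hx).1
    have hsort := sortPair_eq x
    have hroot : Half 0 N x.1 x.2 := by
      obtain ⟨g, hg, hxg⟩ := h.exists_crosser _ hx
      have hg1 := h.lt_of_mem (h.mem_of_mem_edges hg)
      have hg2 := h.le_of_mem (h.mem_of_mem_edges hg)
      unfold Interleave Inside Outside at hxg
      unfold Half
      omega
    obtain ⟨g, hg, hmin⟩ := Finset.exists_min_image
      (P.filter fun g => Half g.1 g.2 x.1 x.2) (fun g => g.2 - g.1)
      ⟨(0, N), Finset.mem_filter.2 ⟨h.root_mem, hroot⟩⟩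
    simp only [Finset.mem_filter] at hg hmin
    refine Finset.mem_biUnion.2 ⟨g, hg.1, h.mem_faceChords.2 ⟨hx, hg.2, fun g' hg' h1 => ?_⟩⟩
    have h4 := hmin g' ⟨hg', h1⟩
    have h5 := h.nested hg' hg.1
    have h6 := hg.2
    unfold Half at h1 h6
    omega
  refine le_trans ?_ Finset.card_biUnion_le
  rw [two_mul]
  nth_rewrite 2 [← Finset.card_image_of_injective _ Prod.swap_injective]
  rw [← Finset.card_union_of_disjoint]
  · apply Finset.card_le_card
    intro x hx
    apply hcover
    rcases Finset.mem_union.1 hx with hx | hx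
    · rwa [sortPair_of_lt (h.lt _ (Finset.mem_sdiff.1 hx).1)]
    · obtain ⟨y, hy, rfl⟩ := Finset.mem_image.1 hx
      have : sortPair y.swap = sortPair y := by
        simp [sortPair, min_comm, max_comm]
      rwa [this, sortPair_of_lt (h.lt _ (Finset.mem_sdiff.1 hy).1)]
  · refine Finset.disjoint_left.2 fun x hx hx' => ?_
    obtain ⟨y, hy, rfl⟩ := Finset.mem_image.1 hx'
    have h1 := h.lt _ (Finset.mem_sdiff.1 hx).1
    have h2 := h.lt _ (Finset.mem_sdiff.1 hy).1
    exact lt_asymm h1 h2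

theorem card_le (h : Skeleton k N E H P) (hk : k ≤ 4) (c : ℕ → Prop)
    (hc : ∀ e ∈ E, ¬ (c e.1 ↔ c e.2)) : 4 * E.card + (2 * k + 7) ≤ (2 * k + 7) * N + 4 := by
  have h1 := h.sum_card_innerVerts_le
  have h2 := h.card_edges_le_sum
  have h3 := h.two_mul_card_le_sum
  have h4 : ∑ g ∈ P, (4 * (faceEdges H P g.1 g.2).card + 2 * (faceChords N E H P g.1 g.2).card) ≤
      ∑ g ∈ P, ((2 * k + 7) * (innerVerts P g.1 g.2).card +
        if (0, N) ∉ H ∧ g = (0, N) then 4 else 0) := by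
    exact Finset.sum_le_sum fun g hg => h.face_le hk c hc hg
  have h5 : ∑ g ∈ P, (if (0, N) ∉ H ∧ g = (0, N) then 4 else 0) = if (0, N) ∈ H then 0 else 4 := by
    by_cases hr : (0, N) ∈ H
    · simp [hr]
    · simp [hr, h.root_mem]
  rw [Finset.sum_add_distrib, Finset.sum_add_distrib, ← Finset.mul_sum, ← Finset.mul_sum,
    ← Finset.mul_sum, h5] at h4
  have h6 := Finset.card_sdiff_add_card_eq_card h.subset
  have h7 := Nat.mul_le_mul_left (2 * k + 7) h1
  rw [Nat.mul_add] at h7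
  split_ifs at h2 h4 <;> omega

end Skeleton

/-- No two chords of `H` interleave. -/
def Noncrossing (H : Finset (ℕ × ℕ)) : Prop :=
  ∀ f ∈ H, ∀ g ∈ H, ¬ Interleave f g

theorem not_interleave_self (f : ℕ × ℕ) : ¬ Interleave f f := by
  unfold Interleave Inside Outside
  omega

theorem Noncrossing.insert {H : Finset (ℕ × ℕ)} (h : Noncrossing H) {f : ℕ × ℕ}
    (hf : ∀ g ∈ H, ¬ Interleave f g) : Noncrossing (insert f H) := by
  intro x hx y hy
  rcases Finset.mem_insert.1 hx with rfl | hx' <;> rcases Finset.mem_insert.1 hy with rfl | hy'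
  · exact not_interleave_self _
  · exact hf y hy'
  · rw [interleave_comm]
    exact hf x hx'
  · exact h x hx' y hy'

theorem exists_skeleton {k N : ℕ} {E : Finset (ℕ × ℕ)} (hN : 0 < N) (hlt : ∀ e ∈ E, e.1 < e.2)
    (hle : ∀ e ∈ E, e.2 ≤ N) (hcross : ∀ e ∈ E, (crossers E e).card ≤ k) :
    ∃ H P, Skeleton k N E H P := by
  obtain ⟨H, hH, hmax⟩ := Finset.exists_max_image (E.powerset.filter Noncrossing) Finset.card
    ⟨∅, by simp [Noncrossing]⟩
  simp only [Finset.mem_filter, Finset.mem_powerset] at hH hmax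
  obtain ⟨hHE, hH⟩ := hH
  refine ⟨H, (Finset.range (N + 1) ×ˢ Finset.range (N + 1)).filter
    (fun f => f ∈ H ∨ (f.2 = f.1 + 1 ∧ f.2 ≤ N) ∨ f = (0, N)), hN, hlt, hle, hcross, hHE,
    fun f => ?_, fun f hf g hg => ?_, fun f hf => ?_, fun f hf f' hf' hne hff' g hg hfg hfg' => ?_⟩
  · simp only [Finset.mem_filter, Finset.mem_product, Finset.mem_range, and_iff_right_iff_imp]
    rintro (hf | hf | rfl)
    · have h1 := hlt f (hHE hf)
      have h2 := hle f (hHE hf)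
      omega
    · omega
    · dsimp only
      omega
  · have hff := (Finset.mem_filter.1 hf).2
    have hgg := (Finset.mem_filter.1 hg).2
    simp only [Finset.mem_filter, Finset.mem_product, Finset.mem_range] at hf hg
    have hf1 := fun hf => hlt f (hHE hf)
    have hg1 := fun hg => hlt g (hHE hg)
    rw [Prod.ext_iff] at hff hgg
    rcases hff with hf' | hff
    · rcases hgg with hg' | hgg
      · exact hH f hf' g hg'
      · have := hf1 hf'
        unfold Interleave Inside Outside
        dsimp only at hgg
        omega
    · unfold Interleave Inside Outside
      dsimp only at hff hgg
      rcases hgg with hg' | hgg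
      · have := hg1 hg'
        omega
      · omega
  · obtain ⟨hfE, hfH⟩ := Finset.mem_sdiff.1 hf
    by_contra! hcon
    have := hmax _ ⟨Finset.insert_subset hfE hHE, hH.insert hcon⟩
    rw [Finset.card_insert_of_notMem hfH] at this
    omega
  · obtain ⟨hfE, hfH⟩ := Finset.mem_sdiff.1 hf
    obtain ⟨hfE', hfH'⟩ := Finset.mem_sdiff.1 hf'
    by_contra! hcon
    have huniq : ∀ e, Interleave e g → (crossers H e).card < 2 →
        ∀ x ∈ H.erase g, ¬ Interleave e x := by
      intro e heg hcard x hx hex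
      obtain ⟨hxg, hx⟩ := Finset.mem_erase.1 hx
      exact hxg (Finset.card_le_one.1 (Nat.lt_succ_iff.1 hcard) x (Finset.mem_filter.2 ⟨hx, hex⟩) g
        (Finset.mem_filter.2 ⟨hg, heg⟩))
    have h1 : Noncrossing (H.erase g) := fun x hx y hy =>
      hH x (Finset.mem_of_mem_erase hx) y (Finset.mem_of_mem_erase hy)
    have h2 := h1.insert (huniq f' hfg' hcon.2)
    have h3 := h2.insert (f := f) fun x hx => by
      rcases Finset.mem_insert.1 hx with rfl | hx
      · exact hff'
      · exact huniq f hfg hcon.1 x hx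
    have h4 := hmax _ ⟨Finset.insert_subset hfE (Finset.insert_subset hfE'
      ((Finset.erase_subset _ _).trans hHE)), h3⟩
    rw [Finset.card_insert_of_notMem (by
      rw [Finset.mem_insert, not_or]
      exact ⟨hne, fun hc => hfH (Finset.mem_of_mem_erase hc)⟩),
      Finset.card_insert_of_notMem fun hc => hfH' (Finset.mem_of_mem_erase hc),
      Finset.card_erase_of_mem hg] at h4
    omega

theorem card_bipartite_le {k N : ℕ} {E : Finset (ℕ × ℕ)} (hk : k ≤ 4) (hN : 0 < N)
    (hlt : ∀ e ∈ E, e.1 < e.2) (hle : ∀ e ∈ E, e.2 ≤ N)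
    (hcross : ∀ e ∈ E, (crossers E e).card ≤ k) (c : ℕ → Prop)
    (hc : ∀ e ∈ E, ¬ (c e.1 ↔ c e.2)) : 4 * E.card + (2 * k + 7) ≤ (2 * k + 7) * N + 4 := by
  obtain ⟨H, P, h⟩ := exists_skeleton hN hlt hle hcross
  exact h.card_le hk c hc

/-- Twice the signed area of the triangle `p a b`. -/
def orient (p a b : Pt) : ℝ := (a 0 - p 0) * (b 1 - p 1) - (a 1 - p 1) * (b 0 - p 0)

theorem ConvexPos.ne_combination {V : Finset Pt} (hV : ConvexPos V) {x p q r : Pt} (hx : x ∈ V)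
    (hp : p ∈ V.erase x) (hq : q ∈ V.erase x) (hr : r ∈ V.erase x) {α β γ : ℝ} (hα : 0 ≤ α)
    (hβ : 0 ≤ β) (hγ : 0 ≤ γ) (hpos : 0 < α + β + γ)
    (h : ∀ i, α * p i + β * q i + γ * r i = (α + β + γ) * x i) : False := by
  refine hV x hx ?_
  have hmem := (convex_convexHull ℝ ((V.erase x : Finset Pt) : Set Pt)).sum_mem
    (t := Finset.univ) (w := ![α / (α + β + γ), β / (α + β + γ), γ / (α + β + γ)])
    (z := ![p, q, r])
    (by
      intro i _
      fin_cases i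
      · exact div_nonneg hα hpos.le
      · exact div_nonneg hβ hpos.le
      · exact div_nonneg hγ hpos.le)
    (by
      simp only [Fin.sum_univ_three, Matrix.cons_val]
      field_simp)
    (by
      intro i _
      fin_cases i
      · exact subset_convexHull ℝ _ hp
      · exact subset_convexHull ℝ _ hq
      · exact subset_convexHull ℝ _ hr)
  convert hmem using 1
  ext i
  simp only [Fin.sum_univ_three, Matrix.cons_val, PiLp.add_apply, PiLp.smul_apply, smul_eq_mul]
  field_simp
  linarith [h i]

/-- `p` precedes `a` in the lexicographic order. -/
def LexBefore (p a : Pt) : Prop := p 0 < a 0 ∨ (p 0 = a 0 ∧ p 1 < a 1)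

theorem exists_lexBefore {V : Finset Pt} (hV : V.Nonempty) :
    ∃ p ∈ V, ∀ a ∈ V, a ≠ p → LexBefore p a := by
  obtain ⟨p, hp, hmin⟩ := Finset.exists_min_image V (fun a => toLex (a 0, a 1)) hV
  refine ⟨p, hp, fun a ha hne => ?_⟩
  rcases Prod.Lex.toLex_le_toLex.1 (hmin a ha) with h | ⟨h1, h2⟩
  · exact Or.inl h
  · refine Or.inr ⟨h1, lt_of_le_of_ne h2 fun h3 => hne ?_⟩
    ext i
    fin_cases i
    · exact h1.symm
    · exact h3.symm

theorem orient_trans {p a b c : Pt} (ha : LexBefore p a) (hb : LexBefore p b) (hc : LexBefore p c)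
    (hab : 0 < orient p a b) (hbc : 0 < orient p b c) : 0 < orient p a c := by
  unfold LexBefore at ha hb hc
  unfold orient at *
  have ha0 : 0 ≤ a 0 - p 0 := by rcases ha with h | h <;> linarith
  have hb0 : 0 ≤ b 0 - p 0 := by rcases hb with h | h <;> linarith
  have hc0 : 0 ≤ c 0 - p 0 := by rcases hc with h | h <;> linarith
  have hb1 : 0 < b 0 - p 0 := by
    rcases hb with h | ⟨h1, h2⟩
    · linarith
    · rw [h1] at hbc hc0
      nlinarith
  have ha1 : 0 < a 0 - p 0 := by
    rcases ha with h | ⟨h1, h2⟩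
    · linarith
    · rw [h1] at hab hb1
      nlinarith
  refine (mul_pos_iff_of_pos_right hb1).1 ?_
  nlinarith [mul_nonneg hab.le hc0, mul_pos hbc ha1]

theorem ConvexPos.orient_ne_zero {V : Finset Pt} (hV : ConvexPos V) {p a b : Pt} (hp : p ∈ V)
    (ha : a ∈ V) (hb : b ∈ V) (hpa : LexBefore p a) (hpb : LexBefore p b) (hap : a ≠ p)
    (hbp : b ≠ p) (hab : a ≠ b) : orient p a b ≠ 0 := by
  intro h
  obtain ⟨s, t, hs, ht, hst⟩ : ∃ s t : ℝ, 0 < s ∧ 0 < t ∧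
      ∀ i, s * (a i - p i) = t * (b i - p i) := by
    unfold orient at h
    unfold LexBefore at hpa hpb
    rcases hpa with hpa | ⟨hpa, hpa'⟩
    · rcases hpb with hpb | ⟨hpb, hpb'⟩
      · refine ⟨b 0 - p 0, a 0 - p 0, by linarith, by linarith, fun i => ?_⟩
        fin_cases i <;> dsimp only [Fin.zero_eta, Fin.mk_one] <;> linarith
      · rw [hpb] at h hpa
        nlinarith
    · rcases hpb with hpb | ⟨hpb, hpb'⟩
      · rw [hpa] at h hpb
        nlinarith
      · refine ⟨b 1 - p 1, a 1 - p 1, by linarith, by linarith, fun i => ?_⟩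
        fin_cases i <;> dsimp only [Fin.zero_eta, Fin.mk_one] <;> linarith
  rcases le_total t s with hle | hle
  · exact hV.ne_combination ha (p := b) (q := p) (r := p) (Finset.mem_erase.2 ⟨hab.symm, hb⟩)
      (Finset.mem_erase.2 ⟨hap.symm, hp⟩) (Finset.mem_erase.2 ⟨hap.symm, hp⟩) ht.le
      (sub_nonneg.2 hle) le_rfl (by linarith) fun i => by linarith [hst i]
  · exact hV.ne_combination hb (p := a) (q := p) (r := p) (Finset.mem_erase.2 ⟨hab, ha⟩)
      (Finset.mem_erase.2 ⟨hbp.symm, hp⟩) (Finset.mem_erase.2 ⟨hbp.symm, hp⟩) hs.le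
      (sub_nonneg.2 hle) le_rfl (by linarith) fun i => by linarith [hst i]

theorem ConvexPos.orient_pos {V : Finset Pt} (hV : ConvexPos V) {p a b c : Pt} (hp : p ∈ V)
    (ha : a ∈ V) (hb : b ∈ V) (hc : c ∈ V) (hab : 0 < orient p a b) (hbc : 0 < orient p b c) :
    0 < orient a b c := by
  by_contra hcon
  have hne : ∀ {x y z : Pt}, 0 < orient x y z → x ≠ y ∧ x ≠ z ∧ y ≠ z := by
    intro x y z h
    refine ⟨?_, ?_, ?_⟩ <;> rintro rfl <;> unfold orient at h <;> nlinarith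
  refine hV.ne_combination hb (p := p) (q := a) (r := c) (α := - orient a b c)
    (Finset.mem_erase.2 ⟨(hne hab).2.1, hp⟩) (Finset.mem_erase.2 ⟨(hne hab).2.2, ha⟩)
    (Finset.mem_erase.2 ⟨(hne hbc).2.2.symm, hc⟩) (by linarith) hbc.le hab.le (by linarith)
    fun i => ?_
  unfold orient
  fin_cases i <;> dsimp only [Fin.zero_eta, Fin.mk_one] <;> ring

theorem openSegment_inter_nonempty {a b c d : Pt} (habc : 0 < orient a b c)
    (habd : 0 < orient a b d) (hacd : 0 < orient a c d) (hbcd : 0 < orient b c d) :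
    (openSegment ℝ a c ∩ openSegment ℝ b d).Nonempty := by
  have hD : orient a b c + orient a c d = orient a b d + orient b c d := by
    unfold orient
    ring
  have hpos : 0 < orient a b d + orient b c d := by linarith
  refine ⟨(orient b c d / (orient a b d + orient b c d)) • a +
    (orient a b d / (orient a b d + orient b c d)) • c,
    ⟨_, _, div_pos hbcd hpos, div_pos habd hpos, by field_simp; ring, rfl⟩,
    ⟨orient a c d / (orient a b d + orient b c d), orient a b c / (orient a b d + orient b c d),
      div_pos hacd hpos, div_pos habc hpos, by field_simp; linarith, ?_⟩⟩
  have key : ∀ i, orient a c d * b i + orient a b c * d i =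
      orient b c d * a i + orient a b d * c i := by
    intro i
    unfold orient
    fin_cases i <;> dsimp only [Fin.zero_eta, Fin.mk_one] <;> ring
  ext i
  simp only [PiLp.add_apply, PiLp.smul_apply, smul_eq_mul]
  field_simp
  linarith [key i]

/-- The points of a set in convex position can be listed in counterclockwise order. -/
theorem ConvexPos.exists_enum {V : Finset Pt} (hV : ConvexPos V) {n : ℕ} (hn : V.card = n)
    (hpos : 0 < n) : ∃ f : Fin n ≃ V, ∀ i j k, i < j → j < k →
      0 < orient (f i : Pt) (f j : Pt) (f k : Pt) := by
  obtain ⟨p, hp, hlex⟩ := exists_lexBefore (Finset.card_pos.1 (hn ▸ hpos))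
  let r : V → V → Prop := fun a b => (a.1 = p ∧ b.1 ≠ p) ∨ 0 < orient p a b
  have hneq : ∀ {a b : Pt}, 0 < orient p a b → a ≠ p ∧ b ≠ p := by
    intro a b h
    refine ⟨?_, ?_⟩ <;> rintro rfl <;> unfold orient at h <;> nlinarith
  have hirr : ∀ a, ¬ r a a := by
    rintro a (⟨h1, h2⟩ | h)
    · exact h2 h1
    · unfold orient at h
      nlinarith
  have htrans : ∀ a b c, r a b → r b c → r a c := by
    rintro a b c (⟨h1, h2⟩ | h1) (⟨h3, h4⟩ | h3)
    · exact absurd h3 h2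
    · exact Or.inl ⟨h1, (hneq h3).2⟩
    · exact absurd h3 (hneq h1).2
    · exact Or.inr (orient_trans (hlex a a.2 (hneq h1).1) (hlex b b.2 (hneq h1).2)
        (hlex c c.2 (hneq h3).2) h1 h3)
  have htri : ∀ a b, ¬ r a b → ¬ r b a → a = b := by
    intro a b hab hba
    by_contra hne
    have hne' : a.1 ≠ b.1 := fun h => hne (Subtype.ext h)
    by_cases hap : a.1 = p
    · exact hab (Or.inl ⟨hap, fun hbp => hne' (hap.trans hbp.symm)⟩)
    by_cases hbp : b.1 = p
    · exact hba (Or.inl ⟨hbp, hap⟩)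
    have h0 := hV.orient_ne_zero hp a.2 b.2 (hlex a a.2 hap) (hlex b b.2 hbp) hap hbp hne'
    rcases h0.lt_or_gt with h | h
    · refine hba (Or.inr ?_)
      unfold orient at h ⊢
      linarith
    · exact hab (Or.inr h)
  have : IsStrictTotalOrder V r :=
    { irrefl := hirr, trans := htrans, trichotomous := htri }
  let _ : LinearOrder V := linearOrderOfSTO r
  refine ⟨(monoEquivOfFin V ((Fintype.card_coe V).trans hn)).toEquiv, fun i j k hij hjk => ?_⟩
  have h1 : r _ _ := (monoEquivOfFin V ((Fintype.card_coe V).trans hn)).strictMono hij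
  have h2 : r _ _ := (monoEquivOfFin V ((Fintype.card_coe V).trans hn)).strictMono hjk
  rcases h2 with h2 | h2
  · rcases h1 with h1 | h1
    · exact absurd h2.1 h1.2
    · exact absurd h2.1 (hneq h1).2
  rcases h1 with h1 | h1
  · rw [← h1.1] at h2
    exact h2
  · exact hV.orient_pos hp (Subtype.prop _) (Subtype.prop _) (Subtype.prop _) h1 h2

/-- for 0 ≤ k ≤ 4, every bipartite outer k-planar graph on
n ≥ 2 vertices has at most ((k + 3.5)·n − (2k + 5)) / 2 edges. -/
theorem stmt14 (k : ℕ) (hk : k ≤ 4) (G : ConvexGeomGraph)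
    (hG : OuterKPlanar G k) (hbip : Bipartite G) (hn : 2 ≤ G.V.card) :
    (G.E.card : ℝ) ≤ (((k : ℝ) + 3.5) * G.V.card - (2 * k + 5)) / 2 := by
  obtain ⟨n, hn'⟩ : ∃ n, G.V.card = n := ⟨_, rfl⟩
  rw [hn'] at hn ⊢
  obtain ⟨f, hf⟩ := G.convexPos.exists_enum hn' (by omega)
  obtain ⟨A, B, hAB, hdisj, hcol⟩ := hbip
  let g : ℕ → Pt := fun i => if h : i < n then (f ⟨i, h⟩ : Pt) else 0
  have hg : ∀ i (h : i < n), g i = f ⟨i, h⟩ := fun i h => dif_pos h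
  have hinj : ∀ i j, i < n → j < n → g i = g j → i = j := by
    intro i j hi hj hij
    rw [hg i hi, hg j hj] at hij
    exact Fin.mk.inj_iff.1 (f.injective (Subtype.ext hij))
  have hsurj : ∀ v ∈ G.V, ∃ i < n, g i = v := fun v hv =>
    ⟨f.symm ⟨v, hv⟩, (f.symm ⟨v, hv⟩).2, by rw [hg _ (f.symm ⟨v, hv⟩).2]; simp⟩
  have hpos : ∀ i j l, i < j → j < l → l < n → 0 < orient (g i) (g j) (g l) := by
    intro i j l hij hjl hl
    rw [hg i (by omega), hg j (by omega), hg l hl]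
    exact hf _ _ _ (Fin.mk_lt_mk.2 hij) (Fin.mk_lt_mk.2 hjl)
  have hseg : ∀ i j l m, i < j → j < l → l < m → m < n →
      (openSegment ℝ (g i) (g l) ∩ openSegment ℝ (g j) (g m)).Nonempty :=
    fun i j l m h1 h2 h3 h4 => openSegment_inter_nonempty (hpos i j l h1 h2 (by omega))
      (hpos i j m h1 (by omega) h4) (hpos i l m (by omega) h3 h4) (hpos j l m h2 h3 h4)
  let φ : ℕ × ℕ → Sym2 Pt := fun x => s(g x.1, g x.2)
  let E := (Finset.range n ×ˢ Finset.range n).filter (fun x => x.1 < x.2 ∧ φ x ∈ G.E)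
  have hE : ∀ x, x ∈ E → x.1 < x.2 ∧ x.2 < n ∧ φ x ∈ G.E := by
    intro x hx
    simp only [E, Finset.mem_filter, Finset.mem_product, Finset.mem_range] at hx
    exact ⟨hx.2.1, hx.1.2, hx.2.2⟩
  have hφ : ∀ x ∈ E, ∀ y ∈ E, φ x = φ y → x = y := by
    intro x hx y hy hxy
    have h1 := hE x hx
    have h2 := hE y hy
    rcases Sym2.eq_iff.1 hxy with ⟨h3, h4⟩ | ⟨h3, h4⟩
    · exact Prod.ext (hinj _ _ (by omega) (by omega) h3) (hinj _ _ (by omega) (by omega) h4)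
    · have h5 := hinj _ _ (by omega) (by omega) h3
      have h6 := hinj _ _ (by omega) (by omega) h4
      omega
  have hcard : G.E.card ≤ E.card := by
    refine (Finset.card_le_card (t := E.image φ) fun e he => ?_).trans Finset.card_image_le
    induction e using Sym2.ind with
    | _ u v =>
      obtain ⟨i, hi, rfl⟩ := hsurj u (G.mem_V _ he u (Sym2.mem_mk_left u v))
      obtain ⟨j, hj, rfl⟩ := hsurj v (G.mem_V _ he v (Sym2.mem_mk_right _ v))
      have hne : i ≠ j := by
        rintro rfl
        exact G.not_diag _ he rfl
      rw [Finset.mem_image]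
      simp only [E, Finset.mem_filter, Finset.mem_product, Finset.mem_range]
      rcases hne.lt_or_gt with hlt | hlt
      · exact ⟨(i, j), ⟨⟨hi, hj⟩, hlt, he⟩, rfl⟩
      · have hswap : φ (j, i) = s(g i, g j) := Sym2.eq_swap
        exact ⟨(j, i), ⟨⟨hj, hi⟩, hlt, by rwa [hswap]⟩, hswap⟩
  have hcross : ∀ x ∈ E, (crossers E x).card ≤ k := by
    intro x hx
    refine le_trans ?_ (hG (φ x) (hE x hx).2.2)
    refine Finset.card_le_card_of_injOn φ (fun y hy => ?_) fun y hy z hz =>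
      hφ y (Finset.mem_filter.1 hy).1 z (Finset.mem_filter.1 hz).1
    obtain ⟨hy, hxy⟩ := Finset.mem_filter.1 hy
    have h1 := hE x hx
    have h2 := hE y hy
    refine Finset.mem_filter.2 ⟨h2.2.2, fun heq => ?_, ?_⟩
    · rw [hφ x hx y hy heq] at hxy
      exact not_interleave_self _ hxy
    · change (openSegment ℝ (g x.1) (g x.2) ∩ openSegment ℝ (g y.1) (g y.2)).Nonempty
      unfold Interleave Inside Outside at hxy
      rcases lt_or_ge x.1 y.1 with h3 | h3
      · exact hseg _ _ _ _ h3 (by omega) (by omega) h2.2.1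
      · rw [Set.inter_comm]
        exact hseg _ _ _ _ (by omega) (by omega) (by omega) h1.2.1
  have hcolor : ∀ x ∈ E, ¬ (g x.1 ∈ A ↔ g x.2 ∈ A) := by
    intro x hx
    obtain ⟨a, ha, b, hb, hab⟩ := hcol _ (hE x hx).2.2
    have hbA : b ∉ A := fun h => Finset.disjoint_left.1 hdisj h hb
    rcases Sym2.eq_iff.1 hab with ⟨h3, h4⟩ | ⟨h3, h4⟩ <;> rw [h3, h4] <;> tauto
  have hmain := card_bipartite_le hk (N := n - 1) (by omega) (fun x hx => (hE x hx).1)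
    (fun x hx => by have := (hE x hx).2.1; omega) hcross (fun i => g i ∈ A) hcolor
  obtain ⟨m, hm⟩ : ∃ m, n = m + 1 := ⟨n - 1, by omega⟩
  rw [hm, Nat.add_sub_cancel] at hmain
  have hreal : 4 * (G.E.card : ℝ) + (2 * k + 7) ≤ (2 * k + 7) * m + 4 := by
    have : 4 * G.E.card + (2 * k + 7) ≤ (2 * k + 7) * m + 4 := by omega
    exact_mod_cast this
  rw [hm]
  push_cast
  linarith
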